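/- Let R be a non-negatively graded Cohen-Macaulay ring with R_0 a Cohen-Macaulay factor ring of a local Gorenstein ring, d = dim R, 𝔪 the maximal homogeneous ideal, k = R/𝔪, and ω = ω_R the graded canonical module. Let (C_•, ∂_•) be a graded complex of finitely generated graded R-modules with M = H_0(C_•), and write (−)^∨ = Hom_R(−, ω). Fix integers i and t with 1 ≤ t ≤ i ≤ d and assume: (1) d − i + t ≤ depth(M/H^0_𝔪(M)); (2) dim H_j(C_•) ≤ d − i + j for all j with 1 ≤ j ≤ i − 1; (3) min{d, d − i + t + j + 1} ≤ depth C_j for all j with 0 ≤ j ≤ i − 1; (4) i − j + 1 ≤ depth C_j^∨ for all j with i − t + 1 ≤ j ≤ i. Then there is a natural homogeneous injection socle(Ext^i_R(M, ω_R)) ↪ Ext^t_R(k, im(∂^∨_{i−t+1})). Moreover t ≤ depth(im(∂^∨_{i−t+1})), and equality holds if depth Ext^i_R(M, ω_R) = 0. -/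

import Mathlib

/-!
Statement 4 (Proposition `SJD-P` of the paper).

`R` is a non-negatively graded Cohen–Macaulay ring with `R₀ = 𝒜 0` a Cohen–Macaulay
factor ring of a local Gorenstein ring, `d = dim R`, `𝔪` the maximal homogeneous
ideal, `k = R/𝔪`, `ω = ω_R` the (graded) canonical module; `(C_•, ∂_•)` is a graded
complex of finitely generated graded `R`-modules, `M = H₀(C_•)`, `(−)^∨ = Hom_R(−, ω)`.
For `1 ≤ t ≤ i ≤ d` with the four depth/dimension hypotheses, the conclusions are:
an injection `socle(Ext^i_R(M, ω)) ↪ Ext^t_R(k, im ∂^∨_{i-t+1})`; moreover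
`t ≤ depth(im ∂^∨_{i-t+1})`, with equality if `depth Ext^i_R(M, ω) = 0`.

The canonical module is characterized (Bruns–Herzog 3.3.28): a finitely generated
maximal Cohen–Macaulay module of type one and of finite injective dimension;
`Ext` is Mathlib's categorical `Ext` over `ModuleCat R`; "Gorenstein local" is
rendered as a Noetherian local ring of finite self-injective dimension.
-/

open CategoryTheory

noncomputable section
namespace Paper

variable {R : Type} [CommRing R]

abbrev extModule (R : Type) [CommRing R] (A B : Type) [AddCommGroup A] [Module R A]
    [AddCommGroup B] [Module R B] (n : ℕ) : Type :=
  ((Ext R (ModuleCat R) n).obj (Opposite.op (ModuleCat.of R A))).obj (ModuleCat.of R B)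

def maxHomIdeal (𝒜 : ℤ → AddSubgroup R) [GradedRing 𝒜] : Ideal R :=
  Ideal.span ({ r : R | ∃ h : r ∈ 𝒜 0, ¬ IsUnit (⟨r, h⟩ : 𝒜 0) } ∪
    ⋃ (i : ℤ) (_ : i ≠ 0), (𝒜 i : Set R))

def depthGE (I : Ideal R) (N : Type) [AddCommGroup N] [Module R N] (k : ℕ) : Prop :=
  Subsingleton N ∨ ∃ rs : List R, rs.length = k ∧ (∀ r ∈ rs, r ∈ I) ∧
    RingTheory.Sequence.IsRegular N rs

def modDimLE (N : Type) [AddCommGroup N] [Module R N] (b : ℕ) : Prop :=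
  ringKrullDim (R ⧸ Module.annihilator R N) ≤ (b : WithBot (WithTop ℕ))

def torsionSubmodule (I : Ideal R) (M : Type) [AddCommGroup M] [Module R M] :
    Submodule R M where
  carrier := { x | ∃ t : ℕ, ∀ r ∈ I ^ t, r • x = 0 }
  zero_mem' := ⟨0, fun r _ => smul_zero r⟩
  add_mem' := by
    rintro a b ⟨t, ht⟩ ⟨m, hm⟩
    refine ⟨t + m, fun r hr => ?_⟩
    have h1 : r ∈ I ^ t := Ideal.pow_le_pow_right (Nat.le_add_right t m) hr
    have h2 : r ∈ I ^ m := Ideal.pow_le_pow_right (Nat.le_add_left m t) hr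
    rw [smul_add, ht r h1, hm r h2, add_zero]
  smul_mem' := by
    rintro c x ⟨t, ht⟩
    exact ⟨t, fun r hr => by rw [smul_comm, ht r hr, smul_zero]⟩

/-- The socle `0 :_N 𝔪` of a module. -/
def socle (I : Ideal R) (N : Type) [AddCommGroup N] [Module R N] : Submodule R N where
  carrier := { x | ∀ r ∈ I, r • x = 0 }
  zero_mem' := fun r _ => smul_zero r
  add_mem' := by
    rintro a b ha hb
    intro r hr
    rw [smul_add, ha r hr, hb r hr, add_zero]
  smul_mem' := by
    rintro c x hx r hr
    rw [smul_comm, hx r hr, smul_zero]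

/-- `W` has finite injective dimension over `S` (tested by eventual vanishing of
`Ext^j(−, W)`). -/
def injDimFinite (S : Type) [CommRing S] (W : Type) [AddCommGroup W] [Module S W] : Prop :=
  ∃ nb : ℕ, ∀ (A : Type) [AddCommGroup A] [Module S A], ∀ j : ℕ, nb < j →
    Subsingleton (extModule S A W j)

/-- A Noetherian local ring of finite self-injective dimension, i.e. Gorenstein. -/
def IsGorensteinLocal (S : Type) [CommRing S] : Prop :=
  IsNoetherianRing S ∧ IsLocalRing S ∧ injDimFinite S S

/-- A Noetherian local Cohen–Macaulay ring. -/
def IsCMLocal (S : Type) [CommRing S] : Prop :=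
  IsNoetherianRing S ∧ ∃ _ : IsLocalRing S, ∃ d₀ : ℕ,
    ringKrullDim S = (d₀ : WithBot (WithTop ℕ)) ∧
    (Subsingleton S ∨ ∃ rs : List S, rs.length = d₀ ∧
      (∀ r ∈ rs, ¬ IsUnit r) ∧ RingTheory.Sequence.IsRegular S rs)

/-- `ω` is a canonical module of the (graded) Cohen–Macaulay ring `R` of dimension `d`
with maximal (homogeneous) ideal `𝔪`: finitely generated, maximal Cohen–Macaulay,
of type one, and of finite injective dimension (Bruns–Herzog 3.3.28). -/
def IsCanonicalModule (𝔪 : Ideal R) (d : ℕ) (ω : Type) [AddCommGroup ω] [Module R ω] :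
    Prop :=
  Module.Finite R ω ∧ depthGE 𝔪 ω d ∧
  Nonempty ((extModule R (R ⧸ 𝔪) ω d) ≃ₗ[R] (R ⧸ 𝔪)) ∧
  injDimFinite R ω

abbrev Hmod (C : ℕ → Type) [∀ j, AddCommGroup (C j)] [∀ j, Module R (C j)]
    (dl : ∀ j, C (j + 1) →ₗ[R] C j) (j : ℕ) : Type :=
  ↥(LinearMap.ker (dl j)) ⧸
    (Submodule.comap (LinearMap.ker (dl j)).subtype (LinearMap.range (dl (j + 1))))


section ExtBasics

open Abelian

variable {A B C D A' B' C' : Type} [AddCommGroup A] [Module R A] [AddCommGroup B] [Module R B]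
  [AddCommGroup C] [Module R C] [AddCommGroup D] [Module R D]
  [AddCommGroup A'] [Module R A'] [AddCommGroup B'] [Module R B']
  [AddCommGroup C'] [Module R C']

/-- `Ext` of modules, as constructed from the derived category. -/
abbrev X (R : Type) [CommRing R] (A B : Type) [AddCommGroup A] [Module R A]
    [AddCommGroup B] [Module R B] (n : ℕ) : Type :=
  Abelian.Ext (ModuleCat.of R A) (ModuleCat.of R B) n

/-- Short exact sequences of modules. -/
structure SES (f : A →ₗ[R] B) (g : B →ₗ[R] C) : Prop where
  inj : Function.Injective f
  exact : Function.Exact f g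
  surj : Function.Surjective g

theorem SES.comp_eq_zero {f : A →ₗ[R] B} {g : B →ₗ[R] C} (h : SES f g) : g.comp f = 0 :=
  h.exact.linearMap_comp_eq_zero

theorem SES.shortExact {f : A →ₗ[R] B} {g : B →ₗ[R] C} (h : SES f g) :
    (ShortComplex.moduleCatMk f g h.comp_eq_zero).ShortExact := by
  have hm : Mono (ModuleCat.ofHom f) := (ModuleCat.mono_iff_injective _).2 h.inj
  have he : Epi (ModuleCat.ofHom g) := (ModuleCat.epi_iff_surjective _).2 h.surj
  refine { exact := ?_, mono_f := hm, epi_g := he }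
  rw [ShortComplex.moduleCat_exact_iff]
  intro x hx
  exact (h.exact x).1 hx

theorem SES.of_surjective (g : B →ₗ[R] C) (hg : Function.Surjective g) :
    SES (LinearMap.ker g).subtype g :=
  ⟨Subtype.val_injective, LinearMap.exact_subtype_ker_map g, hg⟩

theorem SES.of_submodule (N : Submodule R B) : SES N.subtype N.mkQ :=
  ⟨Subtype.val_injective, LinearMap.exact_subtype_mkQ N, N.mkQ_surjective⟩

/-- Functoriality of `Ext` in the first variable. -/
def pre (f : A →ₗ[R] B) (W : Type) [AddCommGroup W] [Module R W] (n : ℕ) :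
    X R B W n →ₗ[R] X R A W n :=
  (Ext.mk₀ (ModuleCat.ofHom f)).precompOfLinear R (ModuleCat.of R W) (zero_add n)

/-- Functoriality of `Ext` in the second variable. -/
def post (N : Type) [AddCommGroup N] [Module R N] (f : A →ₗ[R] B) (n : ℕ) :
    X R N A n →ₗ[R] X R N B n :=
  (Ext.mk₀ (ModuleCat.ofHom f)).postcompOfLinear R (ModuleCat.of R N) (add_zero n)

/-- The connecting map in the first variable. -/
def preδ {f : A →ₗ[R] B} {g : B →ₗ[R] C} (h : SES f g) (W : Type) [AddCommGroup W] [Module R W]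
    (n : ℕ) : X R A W n →ₗ[R] X R C W (n + 1) :=
  h.shortExact.extClass.precompOfLinear R (ModuleCat.of R W) (add_comm 1 n)

/-- The connecting map in the second variable. -/
def postδ (N : Type) [AddCommGroup N] [Module R N] {f : A →ₗ[R] B} {g : B →ₗ[R] C}
    (h : SES f g) (n : ℕ) : X R N C n →ₗ[R] X R N A (n + 1) :=
  h.shortExact.extClass.postcompOfLinear R (ModuleCat.of R N) rfl

section

variable (W : Type) [AddCommGroup W] [Module R W] (n : ℕ)
  {f : A →ₗ[R] B} {g : B →ₗ[R] C}

theorem pre_exact (h : SES f g) : Function.Exact (pre g W n) (pre f W n) :=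
  (ShortComplex.ab_exact_iff_function_exact _).1
    (Ext.contravariant_sequence_exact₂' h.shortExact (ModuleCat.of R W) n)

theorem pre_exact_δ (h : SES f g) : Function.Exact (pre f W n) (preδ h W n) :=
  (ShortComplex.ab_exact_iff_function_exact _).1
    (Ext.contravariant_sequence_exact₁' h.shortExact (ModuleCat.of R W) n (n + 1) (add_comm 1 n))

theorem preδ_exact (h : SES f g) : Function.Exact (preδ h W n) (pre g W (n + 1)) :=
  (ShortComplex.ab_exact_iff_function_exact _).1
    (Ext.contravariant_sequence_exact₃' h.shortExact (ModuleCat.of R W) n (n + 1) (add_comm 1 n))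

theorem post_exact (h : SES f g) : Function.Exact (post W f n) (post W g n) :=
  (ShortComplex.ab_exact_iff_function_exact _).1
    (Ext.covariant_sequence_exact₂' (ModuleCat.of R W) h.shortExact n)

theorem post_exact_δ (h : SES f g) : Function.Exact (post W g n) (postδ W h n) :=
  (ShortComplex.ab_exact_iff_function_exact _).1
    (Ext.covariant_sequence_exact₃' (ModuleCat.of R W) h.shortExact n (n + 1) rfl)

theorem postδ_exact (h : SES f g) : Function.Exact (postδ W h n) (post W f (n + 1)) :=
  (ShortComplex.ab_exact_iff_function_exact _).1
    (Ext.covariant_sequence_exact₁' (ModuleCat.of R W) h.shortExact n (n + 1) rfl)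

theorem pre_zero_injective (hg : Function.Surjective g) : Function.Injective (pre g W 0) :=
  have : Epi (ModuleCat.ofHom g) := (ModuleCat.epi_iff_surjective _).2 hg
  Ext.precomp_mk₀_injective_of_epi (ModuleCat.of R W) (ModuleCat.ofHom g)

theorem post_zero_injective (hf : Function.Injective f) : Function.Injective (post W f 0) :=
  have : Mono (ModuleCat.ofHom f) := (ModuleCat.mono_iff_injective _).2 hf
  Ext.postcomp_mk₀_injective_of_mono (ModuleCat.of R W) (ModuleCat.ofHom f)

theorem pre_comp (f : A →ₗ[R] B) (g : B →ₗ[R] C) :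
    pre (g.comp f) W n = (pre f W n).comp (pre g W n) := by
  ext x
  simp [pre, ModuleCat.ofHom_comp, ← Ext.mk₀_comp_mk₀_assoc]

theorem post_comp (f : A →ₗ[R] B) (g : B →ₗ[R] C) :
    post W (g.comp f) n = (post W g n).comp (post W f n) := by
  ext x
  simp [post, ModuleCat.ofHom_comp]

theorem pre_id : pre (LinearMap.id : A →ₗ[R] A) W n = LinearMap.id := by
  ext x
  simp [pre]

theorem post_id : post W (LinearMap.id : A →ₗ[R] A) n = LinearMap.id := by
  ext x
  simp [post]

theorem pre_smul (r : R) (f : A →ₗ[R] B) : pre (r • f) W n = r • pre f W n := by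
  ext x
  have : ModuleCat.ofHom (r • f) = r • ModuleCat.ofHom f := rfl
  simp [pre, Ext.mk₀_smul, this]

theorem post_smul (r : R) (f : A →ₗ[R] B) : post W (r • f) n = r • post W f n := by
  ext x
  have : ModuleCat.ofHom (r • f) = r • ModuleCat.ofHom f := rfl
  simp [post, Ext.mk₀_smul, this]

theorem pre_zero : pre (0 : A →ₗ[R] B) W n = 0 := by
  simpa using pre_smul W n (0 : R) (0 : A →ₗ[R] B)

theorem post_zero : post W (0 : A →ₗ[R] B) n = 0 := by
  simpa using post_smul W n (0 : R) (0 : A →ₗ[R] B)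

end

theorem preδ_naturality {f : A →ₗ[R] B} {g : B →ₗ[R] C} (h : SES f g)
    {f' : A' →ₗ[R] B'} {g' : B' →ₗ[R] C'} (h' : SES f' g')
    (a : A →ₗ[R] A') (b : B →ₗ[R] B') (c : C →ₗ[R] C')
    (hab : b.comp f = f'.comp a) (hbc : c.comp g = g'.comp b)
    (W : Type) [AddCommGroup W] [Module R W] (n : ℕ) (x : X R A' W n) :
    preδ h W n (pre a W n x) = pre c W (n + 1) (preδ h' W n x) := by
  let φ : ShortComplex.moduleCatMk f g h.comp_eq_zero ⟶
      ShortComplex.moduleCatMk f' g' h'.comp_eq_zero :=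
    { τ₁ := ModuleCat.ofHom a
      τ₂ := ModuleCat.ofHom b
      τ₃ := ModuleCat.ofHom c
      comm₁₂ := by
        apply ModuleCat.hom_ext
        exact hab.symm
      comm₂₃ := by
        apply ModuleCat.hom_ext
        exact hbc.symm }
  have := ShortComplex.ShortExact.extClass_naturality h.shortExact h'.shortExact φ
  have h1 : preδ h W n (pre a W n x) = (h.shortExact.extClass.comp (Ext.mk₀ φ.τ₁)
      (add_zero 1)).comp x (add_comm 1 n) := by
    simp only [preδ, pre]
    exact (Ext.comp_assoc _ _ _ _ (zero_add n) (by omega)).symm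
  have h2 : pre c W (n + 1) (preδ h' W n x) = ((Ext.mk₀ φ.τ₃).comp h'.shortExact.extClass
      (zero_add 1)).comp x (add_comm 1 n) := by
    simp only [preδ, pre]
    exact (Ext.comp_assoc _ _ _ _ (add_comm 1 n) (by omega)).symm
  rw [h1, h2, this]

/-- Degree zero `Ext` is `Hom`. -/
def xZero (A B : Type) [AddCommGroup A] [Module R A] [AddCommGroup B] [Module R B] :
    X R A B 0 ≃ₗ[R] (A →ₗ[R] B) :=
  (Ext.linearEquiv₀ (R := R)).trans (ModuleCat.homLinearEquiv (S := R))

theorem linearEquiv₀_mk₀ {A B : ModuleCat.{0} R} (f : A ⟶ B) :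
    Ext.linearEquiv₀ (R := R) (Ext.mk₀ f) = f :=
  (Ext.linearEquiv₀ (R := R)).apply_symm_apply f

theorem xZero_pre (f : A →ₗ[R] B) (x : X R B C 0) :
    xZero A C (pre f C 0 x) = (xZero B C x).comp f := by
  obtain ⟨y, rfl⟩ := (Ext.linearEquiv₀ (R := R)).symm.surjective x
  simp only [xZero, pre, LinearEquiv.trans_apply]
  simp [ModuleCat.homLinearEquiv, linearEquiv₀_mk₀]
  rfl

/-- `Ext` respects isomorphisms in the first variable. -/
def preEquiv (e : A ≃ₗ[R] B) (W : Type) [AddCommGroup W] [Module R W] (n : ℕ) :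
    X R B W n ≃ₗ[R] X R A W n :=
  LinearEquiv.ofLinearMap (pre e.toLinearMap W n) (pre e.symm.toLinearMap W n)
    (by rw [← pre_comp]; simp [pre_id]) (by rw [← pre_comp]; simp [pre_id])

theorem x_free_subsingleton (W : Type) [AddCommGroup W] [Module R W] (n : ℕ)
    [Module.Projective R A] : Subsingleton (X R A W (n + 1)) :=
  have : Projective (ModuleCat.of R A) := (IsProjective.iff_projective A).1 inferInstance
  Ext.subsingleton_of_projective _ _ _

theorem x_finite [IsNoetherianRing R] [Module.Finite R A] [Module.Finite R B] (n : ℕ) :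
    Module.Finite R (X R A B n) :=
  ModuleCat.finite_ext R (ModuleCat.of R A) (ModuleCat.of R B) n

end ExtBasics

section ExtComparison

open Abelian

variable {A B : Type} [AddCommGroup A] [Module R A] [AddCommGroup B] [Module R B]

/-- The short complex computing derived functor `Ext` from a projective resolution. -/
abbrev resSc {Y : ModuleCat.{0} R} (P : ProjectiveResolution Y) (B : Type) [AddCommGroup B]
    [Module R B] (n : ℕ) : ShortComplex (ModuleCat R) :=
  (P.complex.linearYonedaObj R (ModuleCat.of R B)).sc' n (n + 1) (n + 2)

theorem resSc_cocycle {Y : ModuleCat.{0} R} (P : ProjectiveResolution Y) {n : ℕ}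
    (z : LinearMap.ker (resSc P B n).g.hom) :
    P.complex.d (n + 2) (n + 1) ≫ (z.1 : P.complex.X (n + 1) ⟶ ModuleCat.of R B) = 0 :=
  z.2

theorem extMk_smul {Y Z : ModuleCat.{0} R} (P : ProjectiveResolution Y) {n : ℕ}
    (f : P.complex.X (n + 1) ⟶ Z) (hf : P.complex.d (n + 2) (n + 1) ≫ f = 0) (r : R)
    (hrf : P.complex.d (n + 2) (n + 1) ≫ (r • f) = 0) :
    P.extMk (r • f) (n + 2) rfl hrf = r • P.extMk f (n + 2) rfl hf := by
  rw [Ext.smul_eq_comp_mk₀, P.extMk_comp_mk₀]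
  simp

/-- Cocycles give extension classes. -/
def cocycleToExt {Y : ModuleCat.{0} R} (P : ProjectiveResolution Y) (n : ℕ) :
    LinearMap.ker (resSc P B n).g.hom →ₗ[R] Abelian.Ext Y (ModuleCat.of R B) (n + 1) where
  toFun z := P.extMk z.1 (n + 2) rfl (resSc_cocycle P z)
  map_add' x y := (P.add_extMk _ _ _ _ (resSc_cocycle P x) (resSc_cocycle P y)).symm
  map_smul' r x := by
    exact extMk_smul P _ (resSc_cocycle P x) r (resSc_cocycle P (r • x))

theorem cocycleToExt_surjective {Y : ModuleCat.{0} R} (P : ProjectiveResolution Y) (n : ℕ) :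
    Function.Surjective (cocycleToExt (B := B) P n) := by
  intro x
  obtain ⟨f, hf, rfl⟩ := P.extMk_surjective x (n + 2) rfl
  exact ⟨⟨f, hf⟩, rfl⟩

theorem ker_cocycleToExt {Y : ModuleCat.{0} R} (P : ProjectiveResolution Y) (n : ℕ) :
    LinearMap.ker (cocycleToExt (B := B) P n) =
      LinearMap.range (resSc P B n).moduleCatToCycles := by
  ext z
  rw [LinearMap.mem_ker, LinearMap.mem_range]
  refine (P.extMk_eq_zero_iff z.1 (n + 2) rfl (resSc_cocycle P z) n rfl).trans ?_
  constructor
  · rintro ⟨g, hg⟩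
    exact ⟨g, Subtype.ext hg⟩
  · rintro ⟨g, hg⟩
    exact ⟨g, congrArg Subtype.val hg⟩

/-- Derived functor `Ext` agrees with `Ext` defined via the derived category. -/
def extModuleEquiv (A B : Type) [AddCommGroup A] [Module R A] [AddCommGroup B] [Module R B]
    (n : ℕ) : extModule R A B (n + 1) ≃ₗ[R] X R A B (n + 1) :=
  let P := projectiveResolution (ModuleCat.of R A)
  (P.isoExt (n + 1) (ModuleCat.of R B) ≪≫
    (HomologicalComplex.homologyIsoSc' (P.complex.linearYonedaObj R (ModuleCat.of R B))
      n (n + 1) (n + 2) (by simp) (by simp)) ≪≫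
      (resSc P B n).moduleCatHomologyIso).toLinearEquiv ≪≫ₗ
  (Submodule.quotEquivOfEq _ _ (ker_cocycleToExt P n).symm) ≪≫ₗ
  (cocycleToExt P n).quotKerEquivOfSurjective (cocycleToExt_surjective P n)

end ExtComparison

section Negligible

variable {A B C : Type} [AddCommGroup A] [Module R A] [AddCommGroup B] [Module R B]
  [AddCommGroup C] [Module R C]

/-- A module killed by an element outside the prime `p`; for finite modules this says that the
localization at `p` vanishes. -/
def NegAt (p : Ideal R) (A : Type) [AddCommGroup A] [Module R A] : Prop :=
  ∃ s, s ∉ p ∧ ∀ a : A, s • a = 0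

namespace NegAt

theorem of_injective {p : Ideal R} (h : NegAt p B) (f : A →ₗ[R] B) (hf : Function.Injective f) :
    NegAt p A := by
  obtain ⟨s, hs, h⟩ := h
  exact ⟨s, hs, fun a => hf (by simp [h])⟩

theorem of_surjective {p : Ideal R} (h : NegAt p A) (f : A →ₗ[R] B)
    (hf : Function.Surjective f) : NegAt p B := by
  obtain ⟨s, hs, h⟩ := h
  refine ⟨s, hs, fun b => ?_⟩
  obtain ⟨a, rfl⟩ := hf b
  rw [← map_smul, h, map_zero]

theorem of_equiv {p : Ideal R} (h : NegAt p A) (e : A ≃ₗ[R] B) : NegAt p B :=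
  h.of_surjective e.toLinearMap e.surjective

theorem congr {p : Ideal R} (e : A ≃ₗ[R] B) : NegAt p A ↔ NegAt p B :=
  ⟨fun h => h.of_equiv e, fun h => h.of_equiv e.symm⟩

theorem mono {p q : Ideal R} (h : NegAt p A) (hqp : q ≤ p) : NegAt q A := by
  obtain ⟨s, hs, h⟩ := h
  exact ⟨s, fun hq => hs (hqp hq), h⟩

theorem submodule {p : Ideal R} (h : NegAt p A) (N : Submodule R A) : NegAt p N :=
  h.of_injective N.subtype N.injective_subtype

theorem of_exact {p : Ideal R} [p.IsPrime] {f : A →ₗ[R] B} {g : B →ₗ[R] C}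
    (h : Function.Exact f g) (hA : NegAt p A) (hC : NegAt p C) : NegAt p B := by
  obtain ⟨s, hs, hsA⟩ := hA
  obtain ⟨u, hu, huC⟩ := hC
  refine ⟨s * u, fun hm => ?_, fun b => ?_⟩
  · exact (Ideal.IsPrime.mem_or_mem ‹_› hm).elim hs hu
  · have : g (u • b) = 0 := by rw [map_smul, huC]
    obtain ⟨a, ha⟩ := (h _).1 this
    rw [mul_smul, ← ha, ← map_smul, hsA, map_zero]

theorem of_subsingleton (p : Ideal R) [hp : p.IsPrime] [Subsingleton A] : NegAt p A :=
  ⟨1, fun h => hp.ne_top ((Ideal.eq_top_iff_one p).2 h), fun _ => Subsingleton.elim _ _⟩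

theorem ext_left {p : Ideal R} (h : NegAt p A) (W : Type) [AddCommGroup W] [Module R W] (n : ℕ) :
    NegAt p (X R A W n) := by
  obtain ⟨s, hs, h⟩ := h
  refine ⟨s, hs, fun x => ?_⟩
  have h0 : s • (LinearMap.id : A →ₗ[R] A) = 0 := LinearMap.ext h
  have : pre (s • (LinearMap.id : A →ₗ[R] A)) W n x = s • x := by rw [pre_smul, pre_id]; rfl
  rw [← this, h0, pre_zero, LinearMap.zero_apply]

theorem ext_right {p : Ideal R} (h : NegAt p A) (W : Type) [AddCommGroup W] [Module R W] (n : ℕ) :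
    NegAt p (X R W A n) := by
  obtain ⟨s, hs, h⟩ := h
  refine ⟨s, hs, fun x => ?_⟩
  have h0 : s • (LinearMap.id : A →ₗ[R] A) = 0 := LinearMap.ext h
  have : post W (s • (LinearMap.id : A →ₗ[R] A)) n x = s • x := by rw [post_smul, post_id]; rfl
  rw [← this, h0, post_zero, LinearMap.zero_apply]

theorem quotient_of_not_le {p q : Ideal R} (h : ¬ q ≤ p) : NegAt p (R ⧸ q) := by
  obtain ⟨s, hsq, hsp⟩ := SetLike.not_le_iff_exists.1 h
  refine ⟨s, hsp, fun a => ?_⟩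
  obtain ⟨r, rfl⟩ := Ideal.Quotient.mk_surjective a
  rw [Algebra.smul_def, Ideal.Quotient.algebraMap_eq, Ideal.Quotient.eq_zero_iff_mem.2 hsq,
    zero_mul]

theorem iff_annihilator {p : Ideal R} : NegAt p A ↔ ¬ Module.annihilator R A ≤ p := by
  rw [SetLike.not_le_iff_exists]
  simp only [NegAt, Module.mem_annihilator]
  exact exists_congr fun s => and_comm

theorem not_self_of_prime (p : Ideal R) : ¬ NegAt p R := by
  rintro ⟨s, hs, h⟩
  have := h 1
  simp only [smul_eq_mul, mul_one] at this
  exact hs (this ▸ p.zero_mem)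

theorem subsingleton_of_smul_eq_zero {m : Ideal R} [hm : m.IsMaximal] (h : NegAt m A)
    (hA : ∀ r ∈ m, ∀ a : A, r • a = 0) : Subsingleton A := by
  obtain ⟨s, hs, h⟩ := h
  obtain ⟨u, hu⟩ := hm.exists_inv hs
  obtain ⟨v, hv, huv⟩ := hu
  refine ⟨fun a b => ?_⟩
  have key : ∀ a : A, a = 0 := fun a => by
    have : (u * s + v) • a = a := by rw [huv, one_smul]
    rw [← this, add_smul, mul_smul, h, hA v hv, smul_zero, add_zero]
  rw [key a, key b]

theorem of_nakayama [Module.Finite R A] {p : Ideal R} [hp : p.IsPrime] {x : R} (hx : x ∈ p)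
    {g : A →ₗ[R] C} (h : Function.Exact (LinearMap.lsmul R A x) g) (hC : NegAt p C) :
    NegAt p A := by
  obtain ⟨s, hs, hsC⟩ := hC
  have hr : LinearMap.range (LinearMap.lsmul R A s) ≤ p • (⊤ : Submodule R A) := by
    rintro _ ⟨a, rfl⟩
    obtain ⟨b, hb⟩ := (h (s • a)).1 (by rw [map_smul, hsC])
    rw [LinearMap.lsmul_apply, ← hb]
    exact Submodule.smul_mem_smul hx trivial
  obtain ⟨P, hPm, -, hPc, hP⟩ :=
    LinearMap.exists_monic_and_natDegree_eq_and_coeff_mem_pow_and_aeval_eq_zero R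
      (LinearMap.lsmul R A s) p hr
  refine ⟨P.eval s, fun hmem => ?_, fun a => ?_⟩
  · rw [Polynomial.eval_eq_sum_range, Finset.sum_range_succ, hPm.coeff_natDegree, one_mul] at hmem
    have h2 : ∑ k ∈ Finset.range P.natDegree, P.coeff k * s ^ k ∈ p := by
      refine Ideal.sum_mem _ fun k hk => Ideal.mul_mem_right _ _ ?_
      exact Ideal.pow_le_self (by rw [Finset.mem_range] at hk; omega) (hPc k)
    exact hs (hp.mem_of_pow_mem _ ((Ideal.add_mem_iff_right _ h2).1 hmem))
  · have h1 : (LinearMap.lsmul R A) s = algebraMap R (Module.End R A) s := rfl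
    rw [h1, Polynomial.aeval_algebraMap_apply] at hP
    have := congrArg (fun f : Module.End R A => f a) hP
    simpa using this

theorem subsingleton_of_forall (h : ∀ p : Ideal R, p.IsPrime → NegAt p A) :
    Subsingleton A := by
  by_contra hA
  rw [not_subsingleton_iff_nontrivial] at hA
  have hne : Module.annihilator R A ≠ ⊤ := fun h1 => by
    obtain ⟨a, ha⟩ := exists_ne (0 : A)
    have : (1 : R) ∈ Module.annihilator R A := h1 ▸ trivial
    exact ha (by simpa using Module.mem_annihilator.1 this a)
  obtain ⟨m, hm, hle⟩ := Ideal.exists_le_maximal _ hne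
  exact iff_annihilator.1 (h m hm.isPrime) hle

variable [IsNoetherianRing R]

theorem exists_associatedPrime [Module.Finite R A] {p : Ideal R} [hp : p.IsPrime]
    (h : ¬ NegAt p A) : ∃ q ∈ associatedPrimes R A, q ≤ p := by
  rw [iff_annihilator, not_not] at h
  obtain ⟨q, hq, hqp⟩ := Ideal.exists_minimalPrimes_le h
  exact ⟨q, Module.associatedPrimes.minimalPrimes_annihilator_subset_associatedPrimes R A hq, hqp⟩

/-- If `y` avoids the associated primes of `A` inside `p` then it acts injectively near `p`. -/
theorem ker_of_avoid [Module.Finite R A] {p : Ideal R} [hp : p.IsPrime] {y : R}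
    (hy : ∀ q ∈ associatedPrimes R A, q ≤ p → y ∉ q) :
    NegAt p (LinearMap.ker (LinearMap.lsmul R A y)) := by
  by_contra h
  obtain ⟨q, hq, hqp⟩ := exists_associatedPrime h
  refine hy q (associatedPrimes.subset_of_injective (Submodule.injective_subtype _) hq) hqp ?_
  obtain ⟨hqprime, k, rfl⟩ := isAssociatedPrime_iff.1 hq
  rw [Submodule.mem_colon_singleton, Submodule.mem_bot]
  exact Subtype.ext k.2

theorem not_ext_zero_of_mem {p : Ideal R} (hp : p ∈ associatedPrimes R A) :
    ¬ NegAt p (X R (R ⧸ p) A 0) := by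
  obtain ⟨hpr, f, hf⟩ := isAssociatedPrime_iff_exists_injective_linearMap p A |>.1 hp
  rintro ⟨s, hs, h⟩
  have h1 := h ((xZero (R ⧸ p) A).symm f)
  rw [← map_smul, LinearEquiv.map_eq_zero_iff] at h1
  have h2 : f (s • 1) = 0 := by simpa using LinearMap.congr_fun h1 1
  rw [map_eq_zero_iff f hf, Algebra.smul_def, mul_one, Ideal.Quotient.algebraMap_eq,
    Ideal.Quotient.eq_zero_iff_mem] at h2
  exact hs h2

theorem exists_mem_ker [Module.Finite R A] {p : Ideal R} [hp : p.IsPrime]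
    (h : NegAt p (X R (R ⧸ p) A 0)) :
    ∃ y ∈ p, NegAt p (LinearMap.ker (LinearMap.lsmul R A y)) := by
  have hfin := associatedPrimes.finite R A
  have hnot : ¬ ((p : Set R) ⊆ ⋃ q ∈ {q | q ∈ associatedPrimes R A ∧ q ≤ p}, (q : Set R)) := by
    intro hsub
    obtain ⟨q, ⟨hq, hqp⟩, hpq⟩ := (p.subset_union_prime_finite
      (hfin.subset fun q hq => hq.1) (f := id) 0 0
      fun _ h _ _ => IsAssociatedPrime.isPrime h.1).1 hsub
    obtain rfl : p = q := le_antisymm hpq hqp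
    exact not_ext_zero_of_mem hq h
  obtain ⟨y, hyp, hy⟩ := Set.not_subset.1 hnot
  refine ⟨y, hyp, ker_of_avoid fun q hq hqp hyq => hy ?_⟩
  exact Set.mem_biUnion (show q ∈ {q | q ∈ associatedPrimes R A ∧ q ≤ p} from ⟨hq, hqp⟩) hyq

end NegAt

end Negligible

section QuotientByElement

variable {A N W : Type} [AddCommGroup A] [Module R A] [AddCommGroup N] [Module R N]
  [AddCommGroup W] [Module R W]

/-- Multiplication by `y` as an endomorphism. -/
abbrev mulBy (y : R) (N : Type) [AddCommGroup N] [Module R N] : N →ₗ[R] N :=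
  LinearMap.lsmul R N y

/-- The quotient `N / yN`. -/
abbrev QuotBy (y : R) (N : Type) [AddCommGroup N] [Module R N] : Type :=
  N ⧸ LinearMap.range (mulBy y N)

theorem ses_ker_range {B : Type} [AddCommGroup B] [Module R B] (f : A →ₗ[R] B) :
    SES (LinearMap.ker f).subtype f.rangeRestrict where
  inj := Subtype.val_injective
  exact := by
    intro x
    rw [← LinearMap.mem_ker, LinearMap.ker_rangeRestrict]
    simp
  surj := f.surjective_rangeRestrict

theorem pre_mulBy (y : R) (n : ℕ) (x : X R N W n) : pre (mulBy y N) W n x = y • x := by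
  have : mulBy y N = y • LinearMap.id := rfl
  rw [this, pre_smul, pre_id]
  rfl

theorem post_mulBy (y : R) (n : ℕ) (x : X R A N n) : post A (mulBy y N) n x = y • x := by
  have : mulBy y N = y • LinearMap.id := rfl
  rw [this, post_smul, post_id]
  rfl

theorem pre_range_comp (y : R) (n : ℕ) (x : X R N W n) :
    pre (mulBy y N).rangeRestrict W n
      (pre (LinearMap.range (mulBy y N)).subtype W n x) = y • x := by
  rw [← pre_mulBy, ← LinearMap.comp_apply, ← pre_comp]
  rfl

theorem post_range_comp (y : R) (n : ℕ) (x : X R A N n) :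
    post A (LinearMap.range (mulBy y N)).subtype n
      (post A (mulBy y N).rangeRestrict n x) = y • x := by
  rw [← post_mulBy, ← LinearMap.comp_apply, ← post_comp]
  rfl

namespace NegAt

theorem ext_left_quotBy_zero {p : Ideal R} {y : R} (h : NegAt p (X R N W 0)) :
    NegAt p (X R (QuotBy y N) W 0) :=
  h.of_injective _ (pre_zero_injective W (Submodule.mkQ_surjective _))

variable {p : Ideal R} [p.IsPrime] {y : R}

/-- If `y` kills `A`, vanishing of `Ext(A, N/yN)` shifts to vanishing of `Ext(A, N)`. -/
theorem ext_right_of_quotBy (hy : NegAt p (LinearMap.ker (mulBy y N))) (hA : ∀ a : A, y • a = 0)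
    {j : ℕ} (h : NegAt p (X R A (QuotBy y N) j)) : NegAt p (X R A N (j + 1)) := by
  obtain ⟨u, hu, hu'⟩ := hy.ext_right A (j + 1)
  obtain ⟨s, hs, hs'⟩ := h
  refine ⟨u * s, fun hm => ?_, fun x => ?_⟩
  · exact (Ideal.IsPrime.mem_or_mem ‹_› hm).elim hu hs
  · have hyx : y • x = 0 := by
      rw [← pre_mulBy, show mulBy y A = 0 from LinearMap.ext hA, pre_zero,
        LinearMap.zero_apply]
    rw [← post_range_comp] at hyx
    obtain ⟨z, hz⟩ := (postδ_exact A j (SES.of_submodule (LinearMap.range (mulBy y N))) _).1 hyx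
    have h1 : post A (mulBy y N).rangeRestrict (j + 1) (s • x) = 0 := by
      rw [map_smul, ← hz, ← map_smul, hs', map_zero]
    obtain ⟨v, hv⟩ := (post_exact A (j + 1) (ses_ker_range (mulBy y N)) _).1 h1
    rw [mul_smul, ← hv, ← map_smul, hu', map_zero]

theorem ext_right_quotBy (hy : NegAt p (LinearMap.ker (mulBy y N)))
    {j : ℕ} (h : NegAt p (X R A N j)) (h' : NegAt p (X R A N (j + 1))) :
    NegAt p (X R A (QuotBy y N) j) :=
  of_exact (post_exact_δ A j (SES.of_submodule (LinearMap.range (mulBy y N)))) h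
    (of_exact (post_exact_δ A (j + 1) (ses_ker_range (mulBy y N))) h' (hy.ext_right A _))

theorem ext_left_range (hy : NegAt p (LinearMap.ker (mulBy y N)))
    {j : ℕ} (h : NegAt p (X R N W j)) : NegAt p (X R (LinearMap.range (mulBy y N)) W j) := by
  cases j with
  | zero => exact h.of_injective _ (pre_zero_injective W (ses_ker_range (mulBy y N)).surj)
  | succ j => exact of_exact (preδ_exact W j (ses_ker_range (mulBy y N))) (hy.ext_left W _) h

theorem ext_left_quotBy (hy : NegAt p (LinearMap.ker (mulBy y N)))
    {j : ℕ} (h : NegAt p (X R N W j)) (h' : NegAt p (X R N W (j + 1))) :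
    NegAt p (X R (QuotBy y N) W (j + 1)) :=
  of_exact (preδ_exact W j (SES.of_submodule (LinearMap.range (mulBy y N))))
    (ext_left_range hy h) h'

theorem ext_left_of_quotBy [IsNoetherianRing R] [Module.Finite R N] [Module.Finite R W]
    (hyp : y ∈ p) (hy : NegAt p (LinearMap.ker (mulBy y N)))
    {j : ℕ} (h : NegAt p (X R (QuotBy y N) W (j + 1))) : NegAt p (X R N W j) := by
  have : Module.Finite R (X R N W j) := x_finite j
  refine of_nakayama hyp (LinearMap.exact_map_mkQ_range (mulBy y (X R N W j))) ?_
  obtain ⟨u, hu, hu'⟩ := hy.ext_left W j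
  obtain ⟨s, hs, hs'⟩ := h
  refine ⟨s * u, fun hm => ?_, fun q => ?_⟩
  · exact (Ideal.IsPrime.mem_or_mem ‹_› hm).elim hs hu
  · obtain ⟨x, rfl⟩ := Submodule.mkQ_surjective _ q
    have h1 : pre (LinearMap.ker (mulBy y N)).subtype W j (u • x) = 0 := by rw [map_smul, hu']
    obtain ⟨z, hz⟩ := (pre_exact W j (ses_ker_range (mulBy y N)) _).1 h1
    have h2 : preδ (SES.of_submodule (LinearMap.range (mulBy y N))) W j (s • z) = 0 := by
      rw [map_smul, hs']
    obtain ⟨w, hw⟩ := (pre_exact_δ W j (SES.of_submodule (LinearMap.range (mulBy y N))) _).1 h2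
    rw [← map_smul, Submodule.mkQ_apply, Submodule.Quotient.mk_eq_zero, mul_smul, ← hz,
      ← map_smul, ← hw, pre_range_comp]
    exact ⟨w, rfl⟩

end NegAt

end QuotientByElement

section Dimension

variable {A N W : Type} [AddCommGroup A] [Module R A] [AddCommGroup N] [Module R N]
  [AddCommGroup W] [Module R W]

theorem modDimLE_of_annihilator_le {b : ℕ} (h : modDimLE (R := R) A b)
    (hle : Module.annihilator R A ≤ Module.annihilator R N) : modDimLE (R := R) N b :=
  (ringKrullDim_le_of_surjective (Ideal.Quotient.factor hle)
    (Ideal.Quotient.factor_surjective hle)).trans h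

theorem modDimLE_of_injective {b : ℕ} (h : modDimLE (R := R) A b) (f : N →ₗ[R] A)
    (hf : Function.Injective f) : modDimLE (R := R) N b :=
  modDimLE_of_annihilator_le h (f.annihilator_le_of_injective hf)

theorem modDimLE_of_surjective {b : ℕ} (h : modDimLE (R := R) A b) (f : A →ₗ[R] N)
    (hf : Function.Surjective f) : modDimLE (R := R) N b :=
  modDimLE_of_annihilator_le h (f.annihilator_le_of_surjective hf)

/-- `N / yN` computed in two ways. -/
def quotByEquiv (y : R) (N : Type) [AddCommGroup N] [Module R N] :
    QuotSMulTop y N ≃ₗ[R] QuotBy y N :=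
  Submodule.quotEquivOfEq _ _ (by
    ext x
    simp [Submodule.mem_smul_pointwise_iff_exists])

theorem modDimLE_quotBy [Module.Finite R N] {y : R} (hy : Function.Injective (mulBy y N))
    {b : ℕ} (h : modDimLE (R := R) N b) :
    Subsingleton (QuotBy y N) ∨ ∃ b', b = b' + 1 ∧ modDimLE (R := R) (QuotBy y N) b' := by
  have hreg : IsSMulRegular N y := hy
  have h1 := Module.supportDim_quotSMulTop_succ_le_of_notMem_minimalPrimes (M := N) (x := y)
    fun p hp => hreg.notMem_of_mem_minimalPrimes hp
  rw [Module.supportDim_eq_of_equiv (quotByEquiv y N),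
    Module.supportDim_eq_ringKrullDim_quotient_annihilator R N] at h1
  have h2 := h1.trans h
  by_cases hs : Subsingleton (QuotBy y N)
  · exact Or.inl hs
  right
  have h3 : Module.supportDim R (QuotBy y N) ≠ ⊥ := fun h =>
    hs ((Module.supportDim_eq_bot_iff_subsingleton R _).1 h)
  suffices H : ∃ b', b = b' + 1 ∧ Module.supportDim R (QuotBy y N) ≤ (b' : WithBot ℕ∞) by
    obtain ⟨b', hb, hb'⟩ := H
    rw [Module.supportDim_eq_ringKrullDim_quotient_annihilator] at hb'
    exact ⟨b', hb, hb'⟩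
  generalize Module.supportDim R (QuotBy y N) = D at h2 h3
  obtain ⟨D, rfl⟩ := WithBot.ne_bot_iff_exists.1 h3
  have h4 : D + 1 ≤ (b : ℕ∞) := WithBot.coe_le_coe.1 h2
  have h5 : D ≠ ⊤ := by
    rintro rfl
    exact ENat.natCast_ne_top b (top_le_iff.1 h4)
  lift D to ℕ using h5
  have h6 : D + 1 ≤ b := by exact_mod_cast h4
  exact ⟨b - 1, by omega, WithBot.coe_le_coe.2 (ENat.natCast_le_natCast.2 (by omega))⟩

theorem modDimLE_quotient (p : Ideal R) {b : ℕ} :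
    modDimLE (R := R) (R ⧸ p) b ↔ ringKrullDim (R ⧸ p) ≤ b := by
  rw [modDimLE, Ideal.annihilator_quotient]
  rfl

end Dimension

section Filtration

theorem mulBy_quotient_injective {q : Ideal R} [hq : q.IsPrime] {x : R} (hx : x ∉ q) :
    Function.Injective (mulBy x (R ⧸ q)) := by
  rw [← LinearMap.ker_eq_bot, LinearMap.ker_eq_bot']
  intro a ha
  rw [LinearMap.lsmul_apply, Algebra.smul_def, mul_eq_zero, Ideal.Quotient.algebraMap_eq,
    Ideal.Quotient.eq_zero_iff_mem] at ha
  exact ha.resolve_left hx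

theorem ker_mulBy_negAt {N : Type} [AddCommGroup N] [Module R N] {p : Ideal R} [p.IsPrime] {x : R}
    (h : Function.Injective (mulBy x N)) : NegAt p (LinearMap.ker (mulBy x N)) := by
  have : Subsingleton (LinearMap.ker (mulBy x N)) := by
    rw [LinearMap.ker_eq_bot.2 h]; infer_instance
  exact NegAt.of_subsingleton p

variable [IsNoetherianRing R] {W : Type} [AddCommGroup W] [Module R W]

/-- Dévissage of a vanishing statement `Ext^j(A, W) = 0` near `p` to cyclic modules `R/q` with
`q < p`, where it is enough to treat `Ext^{j+1}(R/(q + x), W)` for one `x`. -/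
theorem negAt_ext_devissage [Module.Finite R W] (p : Ideal R) [hp : p.IsPrime] (j : ℕ)
    (P : Ideal R → Prop) (hP : ∀ I J : Ideal R, I ≤ J → P I → P J)
    (hself : P p → NegAt p (X R (R ⧸ p) W j))
    (hlt : ∀ q : Ideal R, q.IsPrime → P q → q < p → ∃ x ∈ p, x ∉ q ∧
      NegAt p (X R (QuotBy x (R ⧸ q)) W (j + 1)))
    (A : Type) [AddCommGroup A] [Module R A] [hA : Module.Finite R A]
    (hPA : P (Module.annihilator R A)) :
    NegAt p (X R A W j) := by
  induction hA using IsNoetherianRing.induction_on_isQuotientEquivQuotientPrime R with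
  | subsingleton N => exact (NegAt.of_subsingleton (A := N) p).ext_left W j
  | quotient N q e =>
    obtain ⟨q, hq⟩ := q
    refine NegAt.of_equiv ?_ (preEquiv e W j)
    rw [e.annihilator_eq, Ideal.annihilator_quotient] at hPA
    by_cases hqp : q ≤ p
    · rcases hqp.eq_or_lt with rfl | hlt'
      · exact hself hPA
      · obtain ⟨x, hxp, hxq, h⟩ := hlt q hq hPA hlt'
        exact NegAt.ext_left_of_quotBy hxp (ker_mulBy_negAt (mulBy_quotient_injective hxq)) h
    · exact (NegAt.quotient_of_not_le hqp).ext_left W j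
  | exact N₁ N₂ N₃ f g hf hg hfg h₁ h₃ =>
    exact NegAt.of_exact (pre_exact W j ⟨hf, hfg, hg⟩)
      (h₃ (hP _ _ (g.annihilator_le_of_surjective hg) hPA))
      (h₁ (hP _ _ (f.annihilator_le_of_injective hf) hPA))

/-- Ischebeck's vanishing theorem, near a prime `p`. -/
theorem negAt_ext_of_dim [Module.Finite R W] (p : Ideal R) [hp : p.IsPrime] (n c : ℕ)
    (hW : ∀ j < n, NegAt p (X R (R ⧸ p) W j))
    (hc : (c : WithBot (WithTop ℕ)) ≤ ringKrullDim (R ⧸ p)) (b : ℕ) :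
    ∀ (A : Type) [AddCommGroup A] [Module R A] [Module.Finite R A], modDimLE (R := R) A b →
      ∀ j, j + b < n + c → NegAt p (X R A W j) := by
  induction b using Nat.strong_induction_on with
  | _ b ih =>
    intro A _ _ _ hA j hj
    refine negAt_ext_devissage p j (fun I => ringKrullDim (R ⧸ I) ≤ b) ?_ ?_ ?_ A hA
    · intro I J hIJ hI
      exact (ringKrullDim_le_of_surjective (Ideal.Quotient.factor hIJ)
        (Ideal.Quotient.factor_surjective hIJ)).trans hI
    · intro h
      have : c ≤ b := by
        exact ENat.natCast_le_natCast.1 (WithBot.coe_le_coe.1 (hc.trans h))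
      exact hW j (by omega)
    · intro q hq hqb hqp
      obtain ⟨x, hxp, hxq⟩ := SetLike.exists_of_lt hqp
      refine ⟨x, hxp, hxq, ?_⟩
      rcases modDimLE_quotBy (mulBy_quotient_injective hxq) ((modDimLE_quotient q).2 hqb) with
        h | ⟨b', rfl, hb'⟩
      · exact (NegAt.of_subsingleton (A := QuotBy x (R ⧸ q)) p).ext_left W _
      · exact ih b' (by omega) _ hb' (j + 1) (by omega)

theorem negAt_ext_of_top [Module.Finite R W] (p : Ideal R) [hp : p.IsPrime] {nb s : ℕ}
    (hnb : ∀ (A : Type) [AddCommGroup A] [Module R A] [Module.Finite R A] (j : ℕ), nb < j →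
      Subsingleton (X R A W j))
    (hs : ∀ j, s < j → NegAt p (X R (R ⧸ p) W j)) :
    ∀ (A : Type) [AddCommGroup A] [Module R A] [Module.Finite R A] (j : ℕ), s < j →
      NegAt p (X R A W j) := by
  suffices H : ∀ (k : ℕ) (A : Type) [AddCommGroup A] [Module R A] [Module.Finite R A] (j : ℕ),
      s < j → nb < j + k → NegAt p (X R A W j) from
    fun A _ _ _ j hj => H (nb + 1) A j hj (by omega)
  intro k
  induction k with
  | zero =>
    intro A _ _ _ j _ hj
    have := hnb A j hj
    exact NegAt.of_subsingleton p
  | succ k ih =>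
    intro A _ _ _ j hj hjk
    refine negAt_ext_devissage p j (fun _ => True) (fun _ _ _ _ => trivial) (fun _ => hs j hj)
      ?_ A trivial
    intro q hq _ hqp
    obtain ⟨x, hxp, hxq⟩ := SetLike.exists_of_lt hqp
    exact ⟨x, hxp, hxq, ih _ (j + 1) (by omega) (by omega)⟩

theorem exists_injective_of_not_negAt {N : Type} [AddCommGroup N] [Module R N]
    [Module.Finite R N] (p : Ideal R) [hp : p.IsPrime] (h : ¬ NegAt p (X R (R ⧸ p) N 0)) :
    ∃ f : R ⧸ p →ₗ[R] N, Function.Injective f := by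
  have : Module.Finite R (X R (R ⧸ p) N 0) := x_finite 0
  rw [NegAt.congr (xZero (R ⧸ p) N)] at h
  have : Module.Finite R ((R ⧸ p) →ₗ[R] N) := Module.Finite.equiv (xZero (R ⧸ p) N)
  obtain ⟨q, hq, hqp⟩ := NegAt.exists_associatedPrime h
  obtain ⟨-, F, hF⟩ := (isAssociatedPrime_iff_exists_injective_linearMap _ _).1 hq
  refine ⟨F 1, ?_⟩
  rw [← LinearMap.ker_eq_bot, LinearMap.ker_eq_bot']
  intro a ha
  obtain ⟨r, rfl⟩ := Ideal.Quotient.mk_surjective a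
  have h1 : r • F 1 = 0 := by
    refine LinearMap.ext fun b => ?_
    obtain ⟨u, rfl⟩ := Ideal.Quotient.mk_surjective b
    have e1 : Ideal.Quotient.mk p r = r • 1 := by
      rw [Algebra.smul_def, mul_one]; rfl
    have e2 : Ideal.Quotient.mk p u = u • 1 := by
      rw [Algebra.smul_def, mul_one]; rfl
    rw [e1, map_smul] at ha
    rw [e2, map_smul, LinearMap.smul_apply, ha, smul_zero, LinearMap.zero_apply]
  rw [← map_smul, map_eq_zero_iff F hF, Algebra.smul_def, mul_one, Ideal.Quotient.algebraMap_eq,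
    Ideal.Quotient.eq_zero_iff_mem] at h1
  exact Ideal.Quotient.eq_zero_iff_mem.2 (hqp h1)

/-- Nonvanishing of `Ext^g(R/p, N)` bounds the top nonvanishing `Ext(R/p, W)`. -/
theorem negAt_ext_of_grade [Module.Finite R W] (p : Ideal R) [hp : p.IsPrime] (s : ℕ)
    (hs : ∀ (A : Type) [AddCommGroup A] [Module R A] [Module.Finite R A] (j : ℕ), s < j →
      NegAt p (X R A W j)) (g : ℕ) :
    ∀ (N : Type) [AddCommGroup N] [Module R N] [Module.Finite R N],
      ¬ NegAt p (X R (R ⧸ p) N g) → (∀ j, s ≤ j + g → NegAt p (X R N W j)) →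
      NegAt p (X R (R ⧸ p) W s) := by
  induction g with
  | zero =>
    intro N _ _ _ hg hj
    obtain ⟨f, hf⟩ := exists_injective_of_not_negAt p hg
    exact NegAt.of_exact (pre_exact_δ W s ⟨hf, LinearMap.exact_map_mkQ_range f,
      Submodule.mkQ_surjective _⟩) (hj s (by omega)) (hs _ _ (by omega))
  | succ g ih =>
    intro N _ _ _ hg hj
    by_cases h0 : NegAt p (X R (R ⧸ p) N 0)
    · obtain ⟨y, hyp, hy⟩ := NegAt.exists_mem_ker h0
      refine ih (QuotBy y N) (fun h => hg (NegAt.ext_right_of_quotBy hy ?_ h)) ?_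
      · intro a
        obtain ⟨r, rfl⟩ := Ideal.Quotient.mk_surjective a
        rw [Algebra.smul_def, Ideal.Quotient.algebraMap_eq, Ideal.Quotient.eq_zero_iff_mem.2 hyp,
          zero_mul]
      · intro j hjg
        cases j with
        | zero => exact NegAt.ext_left_quotBy_zero (hj 0 (by omega))
        | succ j => exact NegAt.ext_left_quotBy hy (hj j (by omega)) (hj (j + 1) (by omega))
    · obtain ⟨f, hf⟩ := exists_injective_of_not_negAt p h0
      exact NegAt.of_exact (pre_exact_δ W s ⟨hf, LinearMap.exact_map_mkQ_range f,
        Submodule.mkQ_surjective _⟩) (hj s (by omega)) (hs _ _ (by omega))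

/-- The local injective dimension at `p` is at most `depth R_p`. -/
theorem negAt_ext_of_depth_ring [Module.Finite R W] (p : Ideal R) [hp : p.IsPrime] {nb g : ℕ}
    (hnb : ∀ (A : Type) [AddCommGroup A] [Module R A] [Module.Finite R A] (j : ℕ), nb < j →
      Subsingleton (X R A W j))
    (hg : ¬ NegAt p (X R (R ⧸ p) R g)) :
    ∀ (A : Type) [AddCommGroup A] [Module R A] [Module.Finite R A] (j : ℕ), g < j →
      NegAt p (X R A W j) := by
  suffices H : ∀ (k s : ℕ), g ≤ s → nb ≤ s + k → ∀ j, s < j → NegAt p (X R (R ⧸ p) W j) from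
    negAt_ext_of_top p hnb (H nb g le_rfl (by omega))
  intro k
  induction k with
  | zero =>
    intro s _ hs j hj
    have := hnb (R ⧸ p) j (by omega)
    exact NegAt.of_subsingleton p
  | succ k ih =>
    intro s hgs hs j hj
    have h1 := ih (s + 1) (by omega) (by omega)
    rcases Nat.lt_or_ge (s + 1) j with h | h
    · exact h1 j h
    · obtain rfl : j = s + 1 := by omega
      refine negAt_ext_of_grade p (s + 1) (negAt_ext_of_top p hnb h1) g R hg fun j hj => ?_
      obtain ⟨j, rfl⟩ : ∃ j', j = j' + 1 := ⟨j - 1, by omega⟩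
      have := x_free_subsingleton (R := R) (A := R) W j
      exact NegAt.of_subsingleton p

/-- Vanishing of `Ext(N, W)` near `p` governed by the depth of `N`. -/
theorem negAt_ext_of_depth [Module.Finite R W] (p : Ideal R) [hp : p.IsPrime] {g : ℕ}
    (hg : ∀ (A : Type) [AddCommGroup A] [Module R A] [Module.Finite R A] (j : ℕ), g < j →
      NegAt p (X R A W j)) (e : ℕ) :
    ∀ (N : Type) [AddCommGroup N] [Module R N] [Module.Finite R N],
      (∀ j < e, NegAt p (X R (R ⧸ p) N j)) → ∀ j, g < j + e → NegAt p (X R N W j) := by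
  induction e with
  | zero => intro N _ _ _ _ j hj; exact hg N j hj
  | succ e ih =>
    intro N _ _ _ hN j hj
    obtain ⟨y, hyp, hy⟩ := NegAt.exists_mem_ker (hN 0 (by omega))
    refine NegAt.ext_left_of_quotBy hyp hy (ih (QuotBy y N) (fun k hk => ?_) (j + 1) (by omega))
    exact NegAt.ext_right_quotBy hy (hN k (by omega)) (hN (k + 1) (by omega))

end Filtration

section Depth

variable {N : Type} [AddCommGroup N] [Module R N]

theorem ext_residue_smul (m : Ideal R) (A : Type) [AddCommGroup A] [Module R A] (j : ℕ)
    (r : R) (hr : r ∈ m) (x : X R (R ⧸ m) A j) : r • x = 0 := by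
  have h0 : mulBy r (R ⧸ m) = 0 := by
    refine LinearMap.ext fun a => ?_
    obtain ⟨b, rfl⟩ := Ideal.Quotient.mk_surjective a
    rw [LinearMap.lsmul_apply, Algebra.smul_def, Ideal.Quotient.algebraMap_eq,
      Ideal.Quotient.eq_zero_iff_mem.2 hr, zero_mul, LinearMap.zero_apply]
  rw [← pre_mulBy, h0, pre_zero, LinearMap.zero_apply]

theorem NegAt.subsingleton_ext {m : Ideal R} [m.IsMaximal] {j : ℕ}
    (h : NegAt m (X R (R ⧸ m) N j)) : Subsingleton (X R (R ⧸ m) N j) :=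
  h.subsingleton_of_smul_eq_zero (ext_residue_smul m N j)

theorem NegAt.of_smul_top {p : Ideal R} [hp : p.IsPrime] [Module.Finite R N]
    (h : p • (⊤ : Submodule R N) = ⊤) : NegAt p N := by
  obtain ⟨r, hr, hr'⟩ := Submodule.exists_sub_one_mem_and_smul_eq_zero_of_fg_of_le_smul p
    (⊤ : Submodule R N) Module.Finite.fg_top h.ge
  refine ⟨r, fun hrp => hp.ne_top ((Ideal.eq_top_iff_one p).2 ?_), fun a => hr' a trivial⟩
  simpa using p.sub_mem hrp hr

variable [IsNoetherianRing R] {m : Ideal R} [hm : m.IsMaximal] [Module.Finite R N]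

theorem negAt_ext_of_depthGE {n : ℕ} (h : depthGE m N n) {j : ℕ} (hj : j < n) :
    NegAt m (X R (R ⧸ m) N j) := by
  by_cases hN : NegAt m N
  · exact hN.ext_right _ _
  rcases h with h | ⟨rs, rfl, hmem, hreg⟩
  · exact absurd (NegAt.of_subsingleton m) hN
  have := ModuleCat.subsingleton_ext_of_exists_isRegular m (ModuleCat.of R (R ⧸ m)) (by
    rw [Module.support_eq_zeroLocus]
    exact (congrArg _ (congrArg _ Ideal.annihilator_quotient)).le) (ModuleCat.of R N)
    (lt_top_iff_ne_top.2 fun h => hN (NegAt.of_smul_top h)) rs hmem hreg j hj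
  exact NegAt.of_subsingleton m

theorem depthGE_of_negAt_ext {n : ℕ} (hN : ¬ NegAt m N)
    (h : ∀ j < n, NegAt m (X R (R ⧸ m) N j)) : depthGE m N n :=
  Or.inr (ModuleCat.exists_isRegular_of_exists_subsingleton_ext m n (ModuleCat.of R N)
    (lt_top_iff_ne_top.2 fun h => hN (NegAt.of_smul_top h)) (ModuleCat.of R (R ⧸ m)) (by
    rw [Module.support_eq_zeroLocus]
    exact congrArg _ (congrArg _ Ideal.annihilator_quotient)) fun j hj => (h j hj).subsingleton_ext)

theorem exists_mem_injective (h : NegAt m (X R (R ⧸ m) N 0)) :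
    ∃ y ∈ m, Function.Injective (mulBy y N) := by
  have hnot : ¬ ((m : Set R) ⊆ ⋃ q ∈ associatedPrimes R N, (q : Set R)) := by
    intro hsub
    obtain ⟨q, hq, hmq⟩ := (m.subset_union_prime_finite
      (associatedPrimes.finite R N) (f := id) 0 0
      fun _ h _ _ => IsAssociatedPrime.isPrime h).1 hsub
    obtain rfl : m = q := hm.eq_of_le (IsAssociatedPrime.isPrime hq).ne_top hmq
    exact NegAt.not_ext_zero_of_mem hq h
  obtain ⟨y, hym, hy⟩ := Set.not_subset.1 hnot
  refine ⟨y, hym, ?_⟩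
  rw [biUnion_associatedPrimes_eq_compl_regular, Set.mem_compl_iff, not_not] at hy
  exact hy

end Depth

section ZeroMap

theorem ses_mulBy {y : R} {N : Type} [AddCommGroup N] [Module R N]
    (hy : Function.Injective (mulBy y N)) : SES (mulBy y N) (LinearMap.range (mulBy y N)).mkQ :=
  ⟨hy, LinearMap.exact_map_mkQ_range _, Submodule.mkQ_surjective _⟩

/-- The map induced by `φ` modulo `y`. -/
def quotByMap (y : R) {A C : Type} [AddCommGroup A] [Module R A] [AddCommGroup C] [Module R C]
    (φ : A →ₗ[R] C) : QuotBy y A →ₗ[R] QuotBy y C :=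
  Submodule.mapQ _ _ φ (by
    rintro _ ⟨a, rfl⟩
    exact ⟨φ a, by simp⟩)

variable [IsNoetherianRing R] {m : Ideal R} [hm : m.IsMaximal]
  {A C W : Type} [AddCommGroup A] [Module R A] [AddCommGroup C] [Module R C]
  [AddCommGroup W] [Module R W]

theorem NegAt.of_forall_elt {p : Ideal R} [p.IsPrime] [Module.Finite R A]
    (h : ∀ a : A, ∃ s, s ∉ p ∧ s • a = 0) : NegAt p A := by
  by_contra hA
  obtain ⟨q, hq, hqp⟩ := exists_associatedPrime hA
  obtain ⟨-, a, rfl⟩ := isAssociatedPrime_iff.1 hq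
  obtain ⟨s, hs, hsa⟩ := h a
  exact hs (hqp (by rwa [Submodule.mem_colon_singleton, Submodule.mem_bot]))

theorem exists_injective_residue [Module.Finite R A] (hA : ¬ NegAt m A)
    (h : modDimLE (R := R) A 0) : ∃ f : R ⧸ m →ₗ[R] A, Function.Injective f := by
  obtain ⟨q, hq, hqm⟩ := NegAt.exists_associatedPrime hA
  have hqp := IsAssociatedPrime.isPrime hq
  obtain ⟨-, f, hf⟩ := (isAssociatedPrime_iff_exists_injective_linearMap _ _).1 hq
  have h0 : ringKrullDim (R ⧸ q) ≤ (0 : ℕ) :=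
    (modDimLE_quotient q).1 (modDimLE_of_injective h f hf)
  have : Ring.KrullDimLE 0 (R ⧸ q) := (Ring.krullDimLE_iff).2 (by simpa using h0)
  have hfield : IsField (R ⧸ q) := Ring.KrullDimLE.isField_of_isDomain
  obtain rfl : q = m := (Ideal.Quotient.maximal_of_isField q hfield).eq_of_le hm.ne_top hqm
  exact ⟨f, hf⟩

theorem negAt_range_of_quotBy [Module.Finite R C] {x : R} (hx : x ∈ m) (φ : A →ₗ[R] C)
    (h : ∀ r : ℕ, NegAt m (LinearMap.range (quotByMap (x ^ r) φ))) (a : A) :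
    ∃ s, s ∉ m ∧ s • φ a = 0 := by
  have hmem : φ a ∈ (⨅ r : ℕ, m ^ r • ⊤ : Submodule R C) := by
    refine Submodule.mem_iInf _ |>.2 fun r => ?_
    obtain ⟨s, hs, hs'⟩ := h r
    have h1 := congrArg Subtype.val (hs' ⟨quotByMap (x ^ r) φ (Submodule.mkQ _ a), _, rfl⟩)
    have h2 : s • φ a ∈ LinearMap.range (mulBy (x ^ r) C) := by
      rw [← Submodule.Quotient.mk_eq_zero]
      exact h1
    obtain ⟨c, hc⟩ := h2
    have h3 : s • φ a ∈ (m ^ r • ⊤ : Submodule R C) := by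
      rw [← hc]
      exact Submodule.smul_mem_smul (Ideal.pow_mem_pow hx r) trivial
    have hcop : IsCoprime (Ideal.span {s}) (m ^ r) := by
      refine IsCoprime.pow_right ?_
      rw [Ideal.isCoprime_iff_sup_eq, sup_comm]
      exact hm.out.2 _ (left_lt_sup.2 fun h => hs (h (Ideal.mem_span_singleton_self s)))
    obtain ⟨u, hu, v, hv, huv⟩ := Ideal.isCoprime_iff_exists.1 hcop
    obtain ⟨w, rfl⟩ := Ideal.mem_span_singleton'.1 hu
    have : φ a = w • s • φ a + v • φ a := by rw [smul_smul, ← add_smul, huv, one_smul]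
    rw [this]
    exact add_mem (Submodule.smul_mem _ _ h3) (Submodule.smul_mem_smul hv trivial)
  obtain ⟨r, hr⟩ := (Ideal.mem_iInf_smul_pow_eq_bot_iff m (φ a)).1 hmem
  refine ⟨1 - r, fun h => hm.ne_top ((Ideal.eq_top_iff_one m).2 ?_), ?_⟩
  · simpa using m.add_mem h r.2
  · rw [sub_smul, one_smul, sub_eq_zero]
    exact hr.symm

theorem negAt_range_of_dim_zero [Module.Finite R W] {d : ℕ}
    (hW0 : ∀ j < d, NegAt m (X R (R ⧸ m) W j)) (hWd : ¬ NegAt m (X R (R ⧸ m) W d))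
    (hWtop : ∀ (A : Type) [AddCommGroup A] [Module R A] [Module.Finite R A] (j : ℕ), d < j →
      NegAt m (X R A W j))
    [Module.Finite R A] [Module.Finite R C] (φ : A →ₗ[R] C) (hA : modDimLE (R := R) A 0)
    (hφ : NegAt m (LinearMap.range (pre φ W d))) : NegAt m (LinearMap.range φ) := by
  have hker : modDimLE (R := R) (LinearMap.ker φ) 0 :=
    modDimLE_of_injective hA _ (Submodule.injective_subtype _)
  have hrange : modDimLE (R := R) (LinearMap.range φ) 0 :=
    modDimLE_of_surjective hA _ φ.surjective_rangeRestrict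
  have h1 : NegAt m (LinearMap.ker (pre φ.rangeRestrict W d)) := by
    cases d with
    | zero =>
      have : Subsingleton (LinearMap.ker (pre φ.rangeRestrict W 0)) := by
        rw [LinearMap.ker_eq_bot.2 (pre_zero_injective W φ.surjective_rangeRestrict)]
        infer_instance
      exact NegAt.of_subsingleton m
    | succ d =>
      have h2 := negAt_ext_of_dim m (d + 1) 0 hW0 (by
        exact_mod_cast ringKrullDim_nonneg_of_nontrivial) 0 _ hker d (by omega)
      obtain ⟨s, hs, hs'⟩ := h2
      refine ⟨s, hs, fun x => Subtype.ext ?_⟩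
      obtain ⟨z, hz⟩ := (preδ_exact W d (ses_ker_range φ) _).1 x.2
      rw [Submodule.coe_smul, ← hz, ← map_smul, hs', map_zero]
      rfl
  have h3 : NegAt m (X R (LinearMap.range φ) W d) := by
    obtain ⟨u, hu, hu'⟩ := h1
    obtain ⟨v, hv, hv'⟩ := hφ
    obtain ⟨w, hw, hw'⟩ := hWtop (C ⧸ LinearMap.range φ) (d + 1) (by omega)
    have hp := hm.isPrime
    refine ⟨u * (v * w), fun h => (hp.mem_or_mem h).elim hu fun h =>
      (hp.mem_or_mem h).elim hv hw, fun x => ?_⟩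
    have e1 : preδ (SES.of_submodule (LinearMap.range φ)) W d (w • x) = 0 := by
      rw [map_smul, hw']
    obtain ⟨z, hz⟩ := (pre_exact_δ W d (SES.of_submodule (LinearMap.range φ)) _).1 e1
    have e2 : pre φ.rangeRestrict W d (v • w • x) = 0 := by
      rw [← hz, map_smul, ← LinearMap.comp_apply, ← pre_comp]
      exact congrArg Subtype.val (hv' ⟨pre φ W d z, z, rfl⟩)
    rw [mul_smul, mul_smul]
    exact congrArg Subtype.val (hu' ⟨_, e2⟩)
  by_contra hI
  obtain ⟨f, hf⟩ := exists_injective_residue hI hrange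
  exact hWd (NegAt.of_exact (pre_exact_δ W d ⟨hf, LinearMap.exact_map_mkQ_range f,
    Submodule.mkQ_surjective _⟩) h3 (hWtop _ _ (by omega)))

/-- A map between modules of depth and dimension `n` vanishes near `m` as soon as the map it
induces on `Ext^{d-n}(-, W)` does. -/
theorem negAt_range_of_pre [Module.Finite R W] {d : ℕ}
    (hW0 : ∀ j < d, NegAt m (X R (R ⧸ m) W j)) (hWd : ¬ NegAt m (X R (R ⧸ m) W d))
    (hWtop : ∀ (A : Type) [AddCommGroup A] [Module R A] [Module.Finite R A] (j : ℕ), d < j →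
      NegAt m (X R A W j)) (n : ℕ) :
    ∀ (e : ℕ) (A C : Type) [AddCommGroup A] [Module R A] [AddCommGroup C] [Module R C]
      [Module.Finite R A] [Module.Finite R C] (φ : A →ₗ[R] C), e + n = d →
      (∀ j < n, NegAt m (X R (R ⧸ m) A j)) → (∀ j < n, NegAt m (X R (R ⧸ m) C j)) →
      modDimLE (R := R) A n → modDimLE (R := R) C n →
      NegAt m (LinearMap.range (pre φ W e)) → NegAt m (LinearMap.range φ) := by
  induction n with
  | zero =>
    intro e A C _ _ _ _ _ _ φ he _ _ hA _ hφ
    obtain rfl : e = d := he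
    exact negAt_range_of_dim_zero hW0 hWd hWtop φ hA hφ
  | succ n ih =>
    intro e A C _ _ _ _ _ _ φ he hEA hEC hA hC hφ
    have hprod : NegAt m (X R (R ⧸ m) (A × C) 0) :=
      NegAt.of_exact (post_exact (R ⧸ m) 0 (f := LinearMap.inl R A C) (g := LinearMap.snd R A C)
        ⟨LinearMap.inl_injective, Function.Exact.inl_snd, LinearMap.snd_surjective⟩)
        (hEA 0 (by omega)) (hEC 0 (by omega))
    obtain ⟨x, hxm, hx⟩ := exists_mem_injective hprod
    have hxA (r : ℕ) : Function.Injective (mulBy (x ^ r) A) := by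
      have : IsSMulRegular A x := fun a b hab =>
        (Prod.ext_iff.1 (hx (show mulBy x (A × C) (a, 0) = mulBy x (A × C) (b, 0) from
          Prod.ext hab (by simp)))).1
      exact this.pow r
    have hxC (r : ℕ) : Function.Injective (mulBy (x ^ r) C) := by
      have : IsSMulRegular C x := fun a b hab =>
        (Prod.ext_iff.1 (hx (show mulBy x (A × C) (0, a) = mulBy x (A × C) (0, b) from
          Prod.ext (by simp) hab))).2
      exact this.pow r
    refine NegAt.of_forall_elt ?_
    rintro ⟨_, a, rfl⟩
    suffices H : ∀ r : ℕ, NegAt m (LinearMap.range (quotByMap (x ^ r) φ)) by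
      obtain ⟨s, hs, hs'⟩ := negAt_range_of_quotBy hxm φ H a
      exact ⟨s, hs, Subtype.ext hs'⟩
    intro r
    rcases modDimLE_quotBy (hxA r) hA with h | ⟨b, hb, hbA⟩
    · exact (NegAt.of_subsingleton (A := QuotBy (x ^ r) A) m).of_surjective _
        (quotByMap (x ^ r) φ).surjective_rangeRestrict
    rcases modDimLE_quotBy (hxC r) hC with h | ⟨b', hb', hbC⟩
    · exact NegAt.submodule (NegAt.of_subsingleton m) _
    obtain rfl : n = b := by omega
    obtain rfl : n = b' := by omega
    refine ih (e + 1) _ _ _ (by omega)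
      (fun j hj => NegAt.ext_right_quotBy (ker_mulBy_negAt (hxA r)) (hEA j (by omega))
        (hEA (j + 1) (by omega)))
      (fun j hj => NegAt.ext_right_quotBy (ker_mulBy_negAt (hxC r)) (hEC j (by omega))
        (hEC (j + 1) (by omega))) hbA hbC ?_
    obtain ⟨u, hu, hu'⟩ := hφ
    obtain ⟨v, hv, hv'⟩ := negAt_ext_of_depth m hWtop (n + 1) C hEC (e + 1) (by omega)
    refine ⟨u * v, fun h => (hm.isPrime.mem_or_mem h).elim hu hv, ?_⟩
    rintro ⟨_, z, rfl⟩
    have e1 : pre (LinearMap.range (mulBy (x ^ r) C)).mkQ W (e + 1) (v • z) = 0 := by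
      rw [map_smul, hv']
    obtain ⟨w, hw⟩ := (preδ_exact W e (ses_mulBy (hxC r)) _).1 e1
    refine Subtype.ext ?_
    change (u * v) • pre (quotByMap (x ^ r) φ) W (e + 1) z = 0
    rw [mul_smul, ← map_smul, ← hw, ← preδ_naturality (ses_mulBy (hxA r)) (ses_mulBy (hxC r)) φ φ
      (quotByMap (x ^ r) φ) (by ext; simp) (by ext; simp [quotByMap]), ← map_smul,
      show u • pre φ W e w = 0 from congrArg Subtype.val (hu' ⟨pre φ W e w, w, rfl⟩), map_zero]

end ZeroMap

section Gradings

open DirectSum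

variable (𝒜 : ℤ → AddSubgroup R)

/-- A grading of a module, described by the projections to its homogeneous components. This form
passes to stable submodules and quotients without further choices. -/
structure Grading (N : Type) [AddCommGroup N] [Module R N] where
  /-- The projection to a component. -/
  proj : ℤ → N →+ N
  exists_sum : ∀ x, ∃ s : Finset ℤ, x = ∑ i ∈ s, proj i x
  proj_proj_of_ne : ∀ {i j : ℤ}, i ≠ j → ∀ x, proj i (proj j x) = 0
  proj_smul : ∀ {i : ℤ} {a : R}, a ∈ 𝒜 i → ∀ (k : ℤ) (x : N), proj k (a • x) = a • proj (k - i) x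

variable {𝒜} {N : Type} [AddCommGroup N] [Module R N]

theorem proj_mem [GradedRing 𝒜] (i : ℤ) (r : R) : GradedRing.proj 𝒜 i r ∈ 𝒜 i := by
  rw [GradedRing.proj_apply]
  exact SetLike.coe_mem _

namespace Grading

variable (𝒜) in
/-- The grading given by a decomposition. -/
def ofDecomposition (ℳ : ℤ → AddSubgroup N) [Decomposition ℳ] [SetLike.GradedSMul 𝒜 ℳ] :
    Grading 𝒜 N where
  proj i := AddMonoidHom.mk' (fun x => (decompose ℳ x i : N)) fun a b => by
    rw [decompose_add, DirectSum.add_apply, AddSubgroup.coe_add]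
  exists_sum x := by
    classical
    exact ⟨_, (sum_support_decompose ℳ x).symm⟩
  proj_proj_of_ne hij x := decompose_of_mem_ne ℳ (SetLike.coe_mem _) hij.symm
  proj_smul {i a} ha k x := by
    simp only [AddMonoidHom.mk'_apply]
    induction x using Decomposition.inductionOn ℳ with
    | zero => simp
    | @homogeneous j y =>
      have h : a • (y : N) ∈ ℳ (i + j) := SetLike.GradedSMul.smul_mem ha y.2
      rcases eq_or_ne (i + j) k with rfl | hk
      · rw [decompose_of_mem_same ℳ h, add_sub_cancel_left, decompose_of_mem_same ℳ y.2]
      · rw [decompose_of_mem_ne ℳ h hk, decompose_of_mem_ne ℳ y.2 (by omega), smul_zero]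
    | add a b ha hb =>
      simp only [smul_add, decompose_add, DirectSum.add_apply, AddSubgroup.coe_add, ha, hb]

/-- The grading induced on a stable submodule. -/
def submodule (G : Grading 𝒜 N) (K : Submodule R N) (hK : ∀ i, ∀ x ∈ K, G.proj i x ∈ K) :
    Grading 𝒜 K where
  proj i := ((G.proj i).comp K.subtype.toAddMonoidHom).codRestrict K fun x => hK i _ x.2
  exists_sum x := by
    obtain ⟨s, hs⟩ := G.exists_sum x
    exact ⟨s, Subtype.ext (by simpa using hs)⟩
  proj_proj_of_ne hij x := Subtype.ext (G.proj_proj_of_ne hij x)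
  proj_smul ha k x := Subtype.ext (G.proj_smul ha k x)

/-- The grading induced on the quotient by a stable submodule. -/
def quotient (G : Grading 𝒜 N) (K : Submodule R N) (hK : ∀ i, ∀ x ∈ K, G.proj i x ∈ K) :
    Grading 𝒜 (N ⧸ K) where
  proj i := QuotientAddGroup.map K.toAddSubgroup K.toAddSubgroup (G.proj i) (hK i)
  exists_sum x := by
    obtain ⟨x, rfl⟩ := K.mkQ_surjective x
    obtain ⟨s, hs⟩ := G.exists_sum x
    refine ⟨s, (congrArg K.mkQ hs).trans ?_⟩
    rw [map_sum]
    rfl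
  proj_proj_of_ne hij x := by
    obtain ⟨x, rfl⟩ := K.mkQ_surjective x
    exact congrArg K.mkQ (G.proj_proj_of_ne hij x)
  proj_smul ha k x := by
    obtain ⟨x, rfl⟩ := K.mkQ_surjective x
    exact congrArg K.mkQ (G.proj_smul ha k x)

variable (G : Grading 𝒜 N)

theorem proj_self (j : ℤ) (x : N) : G.proj j (G.proj j x) = G.proj j x := by
  obtain ⟨s, hs⟩ := G.exists_sum x
  by_cases hj : j ∈ s
  · conv_rhs => rw [hs, map_sum]
    exact (Finset.sum_eq_single_of_mem j hj fun i _ hij => G.proj_proj_of_ne hij.symm x).symm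
  · have : G.proj j x = 0 := by
      rw [hs, map_sum]
      exact Finset.sum_eq_zero fun i hi =>
        G.proj_proj_of_ne (by rintro rfl; exact hj hi) x
    rw [this, map_zero]

theorem eq_zero_of_proj {x : N} (h : ∀ i, G.proj i x = 0) : x = 0 := by
  obtain ⟨s, hs⟩ := G.exists_sum x
  rw [hs]
  exact Finset.sum_eq_zero fun i _ => h i

theorem exists_bounds (x : N) : ∃ l n : ℕ, ∀ j : ℤ, (j < -l ∨ -l + n ≤ j) → G.proj j x = 0 := by
  obtain ⟨s, hs⟩ := G.exists_sum x
  obtain ⟨b, hb⟩ := (s.image Int.natAbs).bddAbove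
  have hb' (j : ℤ) (hj : j ∈ s) : j.natAbs ≤ b := hb (by
    simpa using ⟨j, hj, rfl⟩)
  refine ⟨b, 2 * b + 1, fun j hj => ?_⟩
  rw [hs, map_sum]
  exact Finset.sum_eq_zero fun i hi =>
    G.proj_proj_of_ne (fun h => by have := hb' i hi; omega) x

theorem proj_mem_ker_mulBy (G : Grading 𝒜 N) {b : ℤ} {y : R} (hy : y ∈ 𝒜 b) (j : ℤ) (x : N)
    (hx : x ∈ LinearMap.ker (mulBy y N)) : G.proj j x ∈ LinearMap.ker (mulBy y N) := by
  have hx' : y • x = 0 := hx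
  have h := G.proj_smul hy (j + b) x
  rw [add_sub_cancel_right, hx', map_zero] at h
  exact h.symm

theorem proj_mem_range_mulBy (G : Grading 𝒜 N) {b : ℤ} {y : R} (hy : y ∈ 𝒜 b) (j : ℤ) (x : N)
    (hx : x ∈ LinearMap.range (mulBy y N)) : G.proj j x ∈ LinearMap.range (mulBy y N) := by
  obtain ⟨z, rfl⟩ := hx
  exact ⟨G.proj (j - b) z, (G.proj_smul hy j z).symm⟩

theorem ofDecomposition_proj_map {N' : Type} [AddCommGroup N'] [Module R N'] (ℳ : ℤ → AddSubgroup N)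
    [Decomposition ℳ] [SetLike.GradedSMul 𝒜 ℳ] (ℳ' : ℤ → AddSubgroup N') [Decomposition ℳ']
    [SetLike.GradedSMul 𝒜 ℳ'] (f : N →ₗ[R] N') (hf : ∀ ℓ, ∀ x ∈ ℳ ℓ, f x ∈ ℳ' ℓ) (j : ℤ)
    (x : N) : (ofDecomposition 𝒜 ℳ').proj j (f x) =
      f ((ofDecomposition 𝒜 ℳ).proj j x) := by
  change (decompose ℳ' (f x) j : N') = f (decompose ℳ x j)
  induction x using Decomposition.inductionOn ℳ with
  | zero => simp
  | @homogeneous i y =>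
    rcases eq_or_ne i j with rfl | hij
    · rw [decompose_of_mem_same ℳ' (hf _ _ y.2), decompose_of_mem_same ℳ y.2]
    · rw [decompose_of_mem_ne ℳ' (hf _ _ y.2) hij, decompose_of_mem_ne ℳ y.2 hij, map_zero]
  | add a b ha hb => simp only [map_add, decompose_add, DirectSum.add_apply,
      AddSubgroup.coe_add, ha, hb]

variable [GradedRing 𝒜]

variable (𝒜) in
/-- The grading of the ring. -/
def self : Grading 𝒜 R := ofDecomposition 𝒜 𝒜

theorem self_proj (i : ℤ) (r : R) : (self 𝒜).proj i r = GradedRing.proj 𝒜 i r := rfl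

theorem exists_proj_smul (f : R) : ∃ s : Finset ℤ, f = ∑ b ∈ s, GradedRing.proj 𝒜 b f ∧
    ∀ (k : ℤ) (x : N), G.proj k (f • x) =
      ∑ b ∈ s, GradedRing.proj 𝒜 b f • G.proj (k - b) x := by
  obtain ⟨s, hs⟩ := (self 𝒜).exists_sum f
  refine ⟨s, hs, fun k x => ?_⟩
  conv_lhs => rw [hs, Finset.sum_smul, map_sum]
  exact Finset.sum_congr rfl fun b _ => G.proj_smul (proj_mem b f) k x

theorem proj_smul_proj (f : R) (k j : ℤ) (x : N) :
    G.proj k (f • G.proj j x) = GradedRing.proj 𝒜 (k - j) f • G.proj j x := by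
  obtain ⟨s, hs, h⟩ := G.exists_proj_smul f
  rw [h]
  by_cases hk : k - j ∈ s
  · rw [Finset.sum_eq_single_of_mem _ hk fun b _ hb => by
      rw [G.proj_proj_of_ne (by omega), smul_zero], sub_sub_cancel, G.proj_self]
  · rw [Finset.sum_eq_zero fun b hb => by
      rw [G.proj_proj_of_ne (by intro h; exact hk (by rwa [show k - j = b by omega])), smul_zero]]
    have : GradedRing.proj 𝒜 (k - j) f = 0 := by
      rw [hs, map_sum]
      exact Finset.sum_eq_zero fun b hb =>
        (self 𝒜).proj_proj_of_ne (by rintro rfl; exact hk hb) f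
    rw [this, zero_smul]

/-- The annihilator of a graded module is homogeneous. -/
theorem proj_smul_eq_zero (G : Grading 𝒜 N) {f : R} (h : ∀ x : N, f • x = 0) (a : ℤ) (x : N) :
    GradedRing.proj 𝒜 a f • x = 0 := by
  obtain ⟨s, hs⟩ := G.exists_sum x
  rw [hs, Finset.smul_sum]
  refine Finset.sum_eq_zero fun j _ => ?_
  have := G.proj_smul_proj f (a + j) j x
  rwa [h, map_zero, add_sub_cancel_right, eq_comm] at this

/-- If `f` kills `x` then a power of the leading component of `f` kills `x`. -/
theorem exists_pow_smul_eq_zero (G : Grading 𝒜 N) {f : R} {a : ℤ}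
    (ha : ∀ b, a < b → GradedRing.proj 𝒜 b f = 0)
    {x : N} (hx : f • x = 0) : ∃ r : ℕ, GradedRing.proj 𝒜 a f ^ r • x = 0 := by
  suffices H : ∀ (n : ℕ) (c : ℤ) (x : N), f • x = 0 →
      (∀ j, (c < j ∨ j ≤ c - n) → G.proj j x = 0) → GradedRing.proj 𝒜 a f ^ n • x = 0 by
    obtain ⟨l, n, h⟩ := G.exists_bounds x
    exact ⟨n, H n (-l + n - 1) x hx fun j hj => h j (by omega)⟩
  intro n
  induction n with
  | zero =>
    intro c x _ hx
    rw [G.eq_zero_of_proj fun j => hx j (by omega), smul_zero]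
  | succ n ih =>
    intro c x hfx hx
    rw [pow_succ, mul_smul]
    refine ih (c + a - 1) _ (by rw [smul_comm, hfx, smul_zero]) fun j hj => ?_
    rw [G.proj_smul (proj_mem a f)]
    rcases eq_or_ne (j - a) c with h | h
    · obtain ⟨s, hs, hs'⟩ := G.exists_proj_smul f
      have h1 := hs' j x
      rw [hfx, map_zero] at h1
      by_cases has : a ∈ s
      · rw [Finset.sum_eq_single_of_mem a has] at h1
        · exact h1.symm
        · intro b _ hb
          rcases lt_or_gt_of_ne hb with hb | hb
          · rw [hx _ (by omega), smul_zero]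
          · rw [ha b hb, zero_smul]
      · have : GradedRing.proj 𝒜 a f = 0 := by
          rw [hs, map_sum]
          exact Finset.sum_eq_zero fun b hb =>
            (self 𝒜).proj_proj_of_ne (by rintro rfl; exact has hb) f
        rw [this, zero_smul]
    · rw [hx _ (by omega), smul_zero]

/-- Associated primes of graded modules are homogeneous. -/
theorem proj_mem_of_associatedPrime (G : Grading 𝒜 N) [IsNoetherianRing R] {P : Ideal R}
    (hP : P ∈ associatedPrimes R N) {f : R} (hf : f ∈ P) (i : ℤ) :
    GradedRing.proj 𝒜 i f ∈ P := by
  obtain ⟨hPp, x, rfl⟩ := isAssociatedPrime_iff.1 hP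
  set P := Submodule.colon (⊥ : Submodule R N) {x} with hPdef
  have hmem (r : R) : r ∈ P ↔ r • x = 0 := by
    rw [hPdef, Submodule.mem_colon_singleton, Submodule.mem_bot]
  suffices H : ∀ (n : ℕ) (l : ℤ) (f : R), f ∈ P →
      (∀ j, (j < l ∨ l + n ≤ j) → GradedRing.proj 𝒜 j f = 0) →
      ∀ i, GradedRing.proj 𝒜 i f ∈ P by
    obtain ⟨l, n, h⟩ := (self 𝒜).exists_bounds f
    exact H n _ f hf h i
  intro n
  induction n with
  | zero =>
    intro l f _ h i
    rw [h i (by omega)]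
    exact P.zero_mem
  | succ n ih =>
    intro l f hf h i
    obtain ⟨r, hr⟩ := G.exists_pow_smul_eq_zero (a := l + n) (fun b hb => h b (by omega))
      ((hmem f).1 hf)
    have htop : GradedRing.proj 𝒜 (l + n) f ∈ P := hPp.mem_of_pow_mem r ((hmem _).2 hr)
    have hsub (j : ℤ) : GradedRing.proj 𝒜 j (f - GradedRing.proj 𝒜 (l + n) f) =
        if j = l + n then 0 else GradedRing.proj 𝒜 j f := by
      rw [map_sub]
      split_ifs with hj
      · subst hj
        exact sub_eq_zero.2 ((self 𝒜).proj_self _ f).symm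
      · rw [show GradedRing.proj 𝒜 j (GradedRing.proj 𝒜 (l + n) f) = 0 from
          (self 𝒜).proj_proj_of_ne hj f, sub_zero]
    have := ih l _ (P.sub_mem hf htop) (fun j hj => by
      rw [hsub]
      split_ifs with h'
      · rfl
      · exact h j (by push_cast; omega)) i
    rw [hsub] at this
    split_ifs at this with h'
    · rwa [h']
    · exact this

end Grading

end Gradings

section MaximalIdeal

open DirectSum

variable {𝒜 : ℤ → AddSubgroup R} [GradedRing 𝒜]

theorem proj_eq_zero_of_neg (hn : ∀ i : ℤ, i < 0 → 𝒜 i = ⊥) {j : ℤ} (hj : j < 0) (r : R) :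
    GradedRing.proj 𝒜 j r = 0 := by
  have := proj_mem (𝒜 := 𝒜) j r
  rwa [hn j hj, AddSubgroup.mem_bot] at this

theorem proj_zero_mul (hn : ∀ i : ℤ, i < 0 → 𝒜 i = ⊥) (a b : R) :
    GradedRing.proj 𝒜 0 (a * b) = GradedRing.proj 𝒜 0 a * GradedRing.proj 𝒜 0 b := by
  obtain ⟨s, hs, h⟩ := (Grading.self 𝒜).exists_proj_smul a
  have h0 := h 0 b
  simp only [Grading.self_proj, smul_eq_mul] at h0
  have hz : ∀ c ∈ s, c ≠ 0 →
      GradedRing.proj 𝒜 c a * GradedRing.proj 𝒜 (0 - c) b = 0 := fun c _ hc => by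
    rcases lt_or_gt_of_ne hc with hc | hc
    · rw [proj_eq_zero_of_neg hn hc, zero_mul]
    · rw [proj_eq_zero_of_neg hn (show 0 - c < 0 by omega), mul_zero]
  rw [h0]
  by_cases h0s : (0 : ℤ) ∈ s
  · rw [Finset.sum_eq_single_of_mem 0 h0s fun c hc hc0 => hz c hc hc0, sub_zero]
  · rw [Finset.sum_eq_zero fun c hc => hz c hc (by rintro rfl; exact h0s hc)]
    have : GradedRing.proj 𝒜 0 a = 0 := by
      rw [hs, map_sum]
      exact Finset.sum_eq_zero fun c hc =>
        (Grading.self 𝒜).proj_proj_of_ne (by rintro rfl; exact h0s hc) a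
    rw [this, zero_mul]

theorem mem_maxHomIdeal_of_ne {i : ℤ} (hi : i ≠ 0) {r : R} (hr : r ∈ 𝒜 i) :
    r ∈ maxHomIdeal 𝒜 :=
  Ideal.subset_span (Or.inr (Set.mem_iUnion₂.2 ⟨i, hi, hr⟩))

theorem sub_proj_zero_mem (r : R) : r - GradedRing.proj 𝒜 0 r ∈ maxHomIdeal 𝒜 := by
  obtain ⟨s, hs⟩ := (Grading.self 𝒜).exists_sum (r - GradedRing.proj 𝒜 0 r)
  rw [hs]
  refine Ideal.sum_mem _ fun i _ => ?_
  rcases eq_or_ne i 0 with rfl | hi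
  · rw [map_sub, show (Grading.self 𝒜).proj 0 (GradedRing.proj 𝒜 0 r) =
      (Grading.self 𝒜).proj 0 r from (Grading.self 𝒜).proj_self 0 r, sub_self]
    exact Ideal.zero_mem _
  · exact mem_maxHomIdeal_of_ne hi (proj_mem i _)

theorem exists_mul_proj_zero_eq_one {s : R} (hs : s ∉ maxHomIdeal 𝒜) :
    ∃ u ∈ 𝒜 0, u * GradedRing.proj 𝒜 0 s = 1 := by
  have hu : IsUnit (⟨GradedRing.proj 𝒜 0 s, proj_mem 0 s⟩ : 𝒜 0) := by
    by_contra h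
    refine hs ?_
    rw [← sub_add_cancel s (GradedRing.proj 𝒜 0 s)]
    exact Ideal.add_mem _ (sub_proj_zero_mem s) (Ideal.subset_span (Or.inl ⟨proj_mem 0 s, h⟩))
  obtain ⟨u, hu⟩ := hu.exists_left_inv
  exact ⟨u, u.2, congrArg Subtype.val hu⟩

theorem maxHomIdeal_isMaximal (hn : ∀ i : ℤ, i < 0 → 𝒜 i = ⊥) [IsLocalRing (𝒜 0)] :
    (maxHomIdeal 𝒜).IsMaximal := by
  refine Ideal.isMaximal_iff.2 ⟨fun h => ?_, fun J x hJ hx hxJ => ?_⟩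
  · have key : ∀ r ∈ maxHomIdeal 𝒜, (⟨GradedRing.proj 𝒜 0 r, proj_mem 0 r⟩ : 𝒜 0) ∈
        IsLocalRing.maximalIdeal (𝒜 0) := fun r hr => by
      induction hr using Submodule.span_induction with
      | mem r hr =>
        rcases hr with ⟨h0, hr⟩ | hr
        · convert (IsLocalRing.mem_maximalIdeal _).2 hr using 2
          exact decompose_of_mem_same 𝒜 h0
        · obtain ⟨i, hi, hr⟩ := Set.mem_iUnion₂.1 hr
          convert Ideal.zero_mem _ using 2
          exact decompose_of_mem_ne 𝒜 hr hi
      | zero =>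
        convert Ideal.zero_mem _ using 2
        exact map_zero _
      | add a b _ _ ha hb =>
        convert Ideal.add_mem _ ha hb using 1
        exact Subtype.ext (map_add _ a b)
      | smul c a _ ha =>
        convert Ideal.mul_mem_left _ (⟨GradedRing.proj 𝒜 0 c, proj_mem 0 c⟩ : 𝒜 0) ha using 1
        exact Subtype.ext (proj_zero_mul hn c a)
    refine (IsLocalRing.mem_maximalIdeal _).1 (key 1 h) ?_
    convert isUnit_one using 1
    exact Subtype.ext (decompose_of_mem_same 𝒜 SetLike.GradedOne.one_mem)
  · obtain ⟨u, -, hu⟩ := exists_mul_proj_zero_eq_one hx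
    have h : u * x - u * (x - GradedRing.proj 𝒜 0 x) = 1 := by rw [← hu]; ring
    rw [← h]
    exact J.sub_mem (J.mul_mem_left u hxJ) (J.mul_mem_left u (hJ (sub_proj_zero_mem x)))

theorem maxHomIdeal_isHomogeneous : (maxHomIdeal 𝒜).IsHomogeneous 𝒜 := by
  refine Ideal.homogeneous_span 𝒜 _ fun x hx => ?_
  rcases hx with ⟨h0, -⟩ | hx
  · exact ⟨0, h0⟩
  · obtain ⟨i, -, hx⟩ := Set.mem_iUnion₂.1 hx
    exact ⟨i, hx⟩

variable {N : Type} [AddCommGroup N] [Module R N]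

namespace Grading

/-- Graded modules vanish as soon as they vanish at the maximal homogeneous ideal. -/
theorem subsingleton_of_negAt (G : Grading 𝒜 N) (h : NegAt (maxHomIdeal 𝒜) N) :
    Subsingleton N := by
  obtain ⟨s, hs, hN⟩ := h
  obtain ⟨u, -, hu⟩ := exists_mul_proj_zero_eq_one hs
  refine subsingleton_of_forall_eq 0 fun x => ?_
  rw [← one_smul R x, ← hu, mul_smul, G.proj_smul_eq_zero hN, smul_zero]

/-- If every homogeneous element of a homogeneous ideal kills the components of `x`, so does the
ideal. -/
theorem smul_proj_eq_zero (G : Grading 𝒜 N) {I : Ideal R} (hI : I.IsHomogeneous 𝒜) {x : N}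
    (hx : ∀ r ∈ I, r • x = 0) (j : ℤ) : ∀ r ∈ I, r • G.proj j x = 0 := fun r hr => by
  obtain ⟨s, hs, -⟩ := G.exists_proj_smul r
  rw [hs, Finset.sum_smul]
  refine Finset.sum_eq_zero fun b _ => ?_
  have h := G.proj_smul (proj_mem b r) (j + b) x
  rw [add_sub_cancel_right, hx (GradedRing.proj 𝒜 b r) (hI b hr), map_zero] at h
  exact h.symm

theorem proj_mem_torsionSubmodule (G : Grading 𝒜 N) (j : ℤ) (x : N)
    (hx : x ∈ torsionSubmodule (maxHomIdeal 𝒜) N) :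
    G.proj j x ∈ torsionSubmodule (maxHomIdeal 𝒜) N := by
  obtain ⟨t, ht⟩ := hx
  have hpow : (maxHomIdeal 𝒜 ^ t).IsHomogeneous 𝒜 := by
    clear ht
    induction t with
    | zero =>
      rw [pow_zero, Ideal.one_eq_top]
      exact fun _ _ _ => trivial
    | succ t ih =>
      rw [pow_succ]
      exact ih.mul maxHomIdeal_isHomogeneous
  exact ⟨t, G.smul_proj_eq_zero hpow ht j⟩

end Grading

theorem NegAt.of_homogeneousCore (G : Grading 𝒜 N) {p : Ideal R}
    (h : NegAt (p.homogeneousCore 𝒜).toIdeal N) : NegAt p N := by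
  obtain ⟨s, hs, hN⟩ := h
  by_contra hp
  refine hs ((HomogeneousIdeal.isHomogeneous _).mem_iff.2 fun a => ?_)
  refine Ideal.mem_homogeneousCore_of_homogeneous_of_mem ⟨a, SetLike.coe_mem _⟩ ?_
  by_contra ha
  exact hp ⟨_, ha, G.proj_smul_eq_zero hN a⟩

end MaximalIdeal

section Avoidance

variable {𝒜 : ℤ → AddSubgroup R} [GradedRing 𝒜]

theorem exists_homogeneous_notMem (hn : ∀ i : ℤ, i < 0 → 𝒜 i = ⊥) {I P : Ideal R}
    (hI : I.IsHomogeneous 𝒜) (h : ¬ I ≤ P) :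
    ∃ (b : ℕ) (x : R), x ∈ 𝒜 b ∧ x ∈ I ∧ x ∉ P := by
  obtain ⟨x, hx, hxP⟩ := SetLike.not_le_iff_exists.1 h
  obtain ⟨s, hs⟩ := (Grading.self 𝒜).exists_sum x
  have : ∃ j, GradedRing.proj 𝒜 j x ∉ P := by
    by_contra! hc
    exact hxP (hs ▸ Ideal.sum_mem _ fun j _ => hc j)
  obtain ⟨j, hj⟩ := this
  have hj0 : 0 ≤ j := by
    by_contra! hneg
    exact hj (proj_eq_zero_of_neg hn hneg x ▸ P.zero_mem)
  lift j to ℕ using hj0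
  exact ⟨j, _, proj_mem _ x, hI j hx, hj⟩

theorem exists_homogeneous_mem_forall (hn : ∀ i : ℤ, i < 0 → 𝒜 i = ⊥) {P : Ideal R}
    [P.IsPrime] (𝒬 : Finset (Ideal R)) (h𝒬 : ∀ I ∈ 𝒬, I.IsHomogeneous 𝒜 ∧ ¬ I ≤ P) :
    ∃ (b : ℕ) (x : R), x ∈ 𝒜 b ∧ (∀ I ∈ 𝒬, x ∈ I) ∧ x ∉ P := by
  classical
  induction 𝒬 using Finset.induction_on with
  | empty => exact ⟨0, 1, by simpa using SetLike.GradedOne.one_mem (A := 𝒜), by simp, P.one_notMem⟩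
  | insert I 𝒬 _ ih =>
    obtain ⟨b, x, hx, hxI, hxP⟩ := ih fun J hJ => h𝒬 J (Finset.mem_insert_of_mem hJ)
    obtain ⟨c, y, hy, hyI, hyP⟩ := exists_homogeneous_notMem hn
      (h𝒬 I (Finset.mem_insert_self _ _)).1 (h𝒬 I (Finset.mem_insert_self _ _)).2
    refine ⟨b + c, x * y, by simpa using SetLike.mul_mem_graded hx hy, fun J hJ => ?_,
      fun h => ((‹P.IsPrime›.mem_or_mem h).elim hxP hyP)⟩
    rcases Finset.mem_insert.1 hJ with rfl | hJ
    · exact J.mul_mem_left x hyI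
    · exact J.mul_mem_right y (hxI J hJ)

/-- Homogeneous prime avoidance. -/
theorem exists_homogeneous_avoid (hn : ∀ i : ℤ, i < 0 → 𝒜 i = ⊥) {q : Ideal R}
    (hq : q.IsHomogeneous 𝒜) {δ : ℕ} (hδ : δ ≠ 0) {z : R} (hz : z ∈ 𝒜 δ)
    (𝒮 : Finset (Ideal R)) (h𝒮 : ∀ P ∈ 𝒮, P.IsPrime ∧ P.IsHomogeneous 𝒜 ∧ ¬ q ≤ P ∧ z ∉ P) :
    ∃ (b : ℕ) (y : R), y ∈ 𝒜 b ∧ y ∈ q ∧ ∀ P ∈ 𝒮, y ∉ P := by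
  classical
  induction 𝒮 using Finset.strongInduction with
  | H 𝒮 ih =>
  rcases 𝒮.eq_empty_or_nonempty with rfl | ⟨P, hP⟩
  · exact ⟨0, 0, zero_mem _, q.zero_mem, by simp⟩
  by_cases hc : ∃ P₁ ∈ 𝒮, ∃ P₂ ∈ 𝒮, P₁ ≠ P₂ ∧ P₁ ≤ P₂
  · obtain ⟨P₁, h₁, P₂, h₂, hne, hle⟩ := hc
    obtain ⟨b, y, hy, hyq, hyP⟩ := ih _ (Finset.erase_ssubset h₁) fun Q hQ =>
      h𝒮 Q (Finset.mem_of_mem_erase hQ)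
    refine ⟨b, y, hy, hyq, fun Q hQ => ?_⟩
    rcases eq_or_ne Q P₁ with rfl | hQ1
    · exact fun h => hyP P₂ (Finset.mem_erase.2 ⟨hne.symm, h₂⟩) (hle h)
    · exact hyP Q (Finset.mem_erase.2 ⟨hQ1, hQ⟩)
  push Not at hc
  obtain ⟨b, y, hy, hyq, hyP⟩ := ih _ (Finset.erase_ssubset hP) fun Q hQ =>
    h𝒮 Q (Finset.mem_of_mem_erase hQ)
  by_cases hyP' : y ∈ P
  swap
  · refine ⟨b, y, hy, hyq, fun Q hQ => ?_⟩
    rcases eq_or_ne Q P with rfl | hQ1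
    · exact hyP'
    · exact hyP Q (Finset.mem_erase.2 ⟨hQ1, hQ⟩)
  obtain ⟨hPp, -, hqP, hzP⟩ := h𝒮 P hP
  obtain ⟨e, w, hw, hwI, hwP⟩ := exists_homogeneous_mem_forall hn (P := P)
    (insert q (𝒮.erase P)) fun I hI => by
      rcases Finset.mem_insert.1 hI with rfl | hI
      · exact ⟨hq, hqP⟩
      · exact ⟨(h𝒮 I (Finset.mem_of_mem_erase hI)).2.1,
          hc I (Finset.mem_of_mem_erase hI) P hP (Finset.ne_of_mem_erase hI)⟩
  have hwq : w ∈ q := hwI q (Finset.mem_insert_self _ _)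
  refine ⟨δ * (b + e), y ^ δ * z ^ e + w ^ δ * z ^ b, ?_, ?_, fun Q hQ h => ?_⟩
  · refine add_mem ?_ ?_
    · convert SetLike.mul_mem_graded (SetLike.pow_mem_graded δ hy)
        (SetLike.pow_mem_graded e hz) using 1
      simp only [nsmul_eq_mul]
      push_cast
      ring_nf
    · convert SetLike.mul_mem_graded (SetLike.pow_mem_graded δ hw)
        (SetLike.pow_mem_graded b hz) using 1
      simp only [nsmul_eq_mul]
      push_cast
      ring_nf
  · exact q.add_mem (q.mul_mem_right _ (q.pow_mem_of_mem hyq δ (Nat.pos_of_ne_zero hδ)))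
      (q.mul_mem_right _ (q.pow_mem_of_mem hwq δ (Nat.pos_of_ne_zero hδ)))
  · obtain ⟨hQp, -, -, hzQ⟩ := h𝒮 Q hQ
    rcases eq_or_ne Q P with rfl | hQ1
    · have h1 := (Q.add_mem_iff_right (Q.mul_mem_right (z ^ e)
        (Q.pow_mem_of_mem hyP' δ (Nat.pos_of_ne_zero hδ)))).1 h
      exact (hQp.mem_or_mem h1).elim (fun h => hwP (hQp.mem_of_pow_mem _ h))
        fun h => hzQ (hQp.mem_of_pow_mem _ h)
    · have hQ' : Q ∈ 𝒮.erase P := Finset.mem_erase.2 ⟨hQ1, hQ⟩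
      have h1 := (Q.add_mem_iff_left (Q.mul_mem_right (z ^ b)
        (Q.pow_mem_of_mem (hwI Q (Finset.mem_insert_of_mem hQ')) δ
          (Nat.pos_of_ne_zero hδ)))).1 h
      exact (hQp.mem_or_mem h1).elim (fun h => hyP Q hQ' (hQp.mem_of_pow_mem _ h))
        fun h => hzQ (hQp.mem_of_pow_mem _ h)

end Avoidance

section GradedVanishing

variable {𝒜 : ℤ → AddSubgroup R} [GradedRing 𝒜]

theorem proj_mem_homogeneousCore {p : Ideal R} {j : ℤ} {g : R}
    (h : GradedRing.proj 𝒜 j g ∈ p) : GradedRing.proj 𝒜 j g ∈ (p.homogeneousCore 𝒜).toIdeal :=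
  Ideal.mem_homogeneousCore_of_homogeneous_of_mem ⟨j, proj_mem j g⟩ h

/-- Up to elements outside `p`, a prime is generated by a single element over its homogeneous
core, and this element can be taken with leading component outside `p`. -/
theorem exists_pseudo_generator {p : Ideal R} [p.IsPrime]
    (hp : ¬ p ≤ (p.homogeneousCore 𝒜).toIdeal) :
    ∃ f ∈ p, ∃ a : ℤ, (∀ b, a < b → GradedRing.proj 𝒜 b f = 0) ∧ GradedRing.proj 𝒜 a f ∉ p ∧
      ∀ g ∈ p, ∃ h ∉ p, ∃ c, h * g - c * f ∈ (p.homogeneousCore 𝒜).toIdeal := by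
  classical
  set q := (p.homogeneousCore 𝒜).toIdeal with hq
  have hqp : q ≤ p := Ideal.toIdeal_homogeneousCore_le 𝒜 p
  let Sp (l : ℤ) (n : ℕ) (f : R) : Prop :=
    ∀ j : ℤ, (j < l ∨ l + n ≤ j) → GradedRing.proj 𝒜 j f = 0
  have hzero {l : ℤ} {f : R} (h : Sp l 0 f) : f = 0 :=
    (Grading.self 𝒜).eq_zero_of_proj fun j => h j (by simpa using lt_or_ge j l)
  have hsub (l : ℤ) (n : ℕ) (f : R) (h : Sp l (n + 1) f) :
      Sp l n (f - GradedRing.proj 𝒜 (l + n) f) := fun j hj => by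
    rw [map_sub]
    rcases eq_or_ne j (l + n) with rfl | hj'
    · exact sub_eq_zero.2 ((Grading.self 𝒜).proj_self _ f).symm
    · rw [show GradedRing.proj 𝒜 j (GradedRing.proj 𝒜 (l + n) f) = 0 from
        (Grading.self 𝒜).proj_proj_of_ne hj' f, sub_zero]
      exact h j (by push_cast; omega)
  have hex : ∃ n : ℕ, ∃ f ∈ p, f ∉ q ∧ ∃ l, Sp l n f := by
    obtain ⟨f, hf, hfq⟩ := SetLike.not_le_iff_exists.1 hp
    obtain ⟨l, n, h⟩ := (Grading.self 𝒜).exists_bounds f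
    exact ⟨n, f, hf, hfq, _, h⟩
  obtain ⟨f, hf, hfq, l, hfl⟩ := Nat.find_spec hex
  have hmin {n : ℕ} (hn : n < Nat.find hex) {g : R} (hg : g ∈ p) {l : ℤ} (h : Sp l n g) :
      g ∈ q := by
    by_contra hgq
    exact Nat.find_min hex hn ⟨g, hg, hgq, l, h⟩
  obtain ⟨W, hW⟩ : ∃ W, Nat.find hex = W + 1 := by
    refine Nat.exists_eq_succ_of_ne_zero fun h => hfq ?_
    rw [h] at hfl
    exact hzero hfl ▸ q.zero_mem
  rw [hW] at hfl hmin
  have hfa : GradedRing.proj 𝒜 (l + W) f ∉ p := fun h => by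
    have h1 := hmin (Nat.lt_succ_self W) (p.sub_mem hf h) (hsub l W f hfl)
    exact hfq (by simpa using q.add_mem h1 (proj_mem_homogeneousCore h))
  refine ⟨f, hf, l + W, fun b hb => hfl b (by push_cast; omega), hfa, fun g hg => ?_⟩
  obtain ⟨l', n, h⟩ := (Grading.self 𝒜).exists_bounds g
  generalize (-l' : ℤ) = l' at h
  induction n generalizing l' g with
  | zero => exact ⟨1, p.one_notMem, 0, by
      rw [hzero h]
      simp⟩
  | succ m ih =>
    by_cases hgb : GradedRing.proj 𝒜 (l' + m) g ∈ p
    · obtain ⟨h', hh', c, hc⟩ := ih _ (p.sub_mem hg hgb) _ (hsub l' m g h)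
      refine ⟨h', hh', c, ?_⟩
      have := q.add_mem hc (q.mul_mem_left h' (proj_mem_homogeneousCore hgb))
      convert this using 1
      ring
    by_cases hm : m + 1 < W + 1
    · exact ⟨1, p.one_notMem, 0, by simpa using hmin hm hg h⟩
    have hfp := proj_mem (𝒜 := 𝒜) (l + W) f
    have hgp := proj_mem (𝒜 := 𝒜) (l' + m) g
    have hf' (j : ℤ) : GradedRing.proj 𝒜 j (GradedRing.proj 𝒜 (l + W) f * g) =
        GradedRing.proj 𝒜 (l + W) f * GradedRing.proj 𝒜 (j - (l + W)) g :=
      (Grading.self 𝒜).proj_smul hfp j g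
    have hg' (j : ℤ) : GradedRing.proj 𝒜 j (GradedRing.proj 𝒜 (l' + m) g * f) =
        GradedRing.proj 𝒜 (l' + m) g * GradedRing.proj 𝒜 (j - (l' + m)) f :=
      (Grading.self 𝒜).proj_smul hgp j f
    obtain ⟨h', hh', c, hc⟩ := ih
      (GradedRing.proj 𝒜 (l + W) f * g - GradedRing.proj 𝒜 (l' + m) g * f)
      (p.sub_mem (p.mul_mem_left _ hg) (p.mul_mem_left _ hf)) (l' + (l + W)) fun j hj => by
        change GradedRing.proj 𝒜 j _ = 0
        rw [map_sub, hf', hg']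
        rcases eq_or_ne j (l' + m + (l + W)) with rfl | hj'
        · rw [add_sub_cancel_right, add_sub_cancel_left, mul_comm, sub_self]
        · rw [show GradedRing.proj 𝒜 (j - (l + W)) g = 0 from h _ (by push_cast; omega),
            show GradedRing.proj 𝒜 (j - (l' + m)) f = 0 from hfl _ (by push_cast; omega)]
          simp
    refine ⟨h' * GradedRing.proj 𝒜 (l + W) f,
      fun hmem => (‹p.IsPrime›.mem_or_mem hmem).elim hh' hfa,
      c + h' * GradedRing.proj 𝒜 (l' + m) g, ?_⟩
    convert hc using 1
    ring

theorem le_maxHomIdeal {q : Ideal R} (hq : q.IsHomogeneous 𝒜) (h1 : q ≠ ⊤) :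
    q ≤ maxHomIdeal 𝒜 := fun x hx => by
  rw [← sub_add_cancel x (GradedRing.proj 𝒜 0 x)]
  refine Ideal.add_mem _ (sub_proj_zero_mem x)
    (Ideal.subset_span (Or.inl ⟨proj_mem 0 x, fun hu => h1 ?_⟩))
  obtain ⟨u, hu⟩ := hu.exists_left_inv
  have hu' : (u : R) * GradedRing.proj 𝒜 0 x = 1 := congrArg Subtype.val hu
  rw [Ideal.eq_top_iff_one, ← hu']
  exact q.mul_mem_left (u : R) (hq 0 hx)

theorem exists_homogeneous_pos_notMem (hn : ∀ i : ℤ, i < 0 → 𝒜 i = ⊥) {p : Ideal R}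
    [p.IsPrime] (hp : ¬ p ≤ maxHomIdeal 𝒜) :
    ∃ δ : ℕ, δ ≠ 0 ∧ ∃ z ∈ 𝒜 δ, z ∉ p := by
  by_contra! hc
  obtain ⟨f, hf, hfm⟩ := SetLike.not_le_iff_exists.1 hp
  obtain ⟨u, -, hu⟩ := exists_mul_proj_zero_eq_one hfm
  have hmem : f - GradedRing.proj 𝒜 0 f ∈ p := by
    obtain ⟨s, hs⟩ := (Grading.self 𝒜).exists_sum (f - GradedRing.proj 𝒜 0 f)
    rw [hs]
    refine Ideal.sum_mem _ fun i _ => ?_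
    rcases lt_trichotomy i 0 with hi | rfl | hi
    · rw [Grading.self_proj, proj_eq_zero_of_neg hn hi]
      exact p.zero_mem
    · rw [map_sub, show (Grading.self 𝒜).proj 0 (GradedRing.proj 𝒜 0 f) =
        (Grading.self 𝒜).proj 0 f from (Grading.self 𝒜).proj_self 0 f, sub_self]
      exact p.zero_mem
    · lift i to ℕ using hi.le
      exact hc i (by omega) _ (proj_mem _ _)
  have h0 : GradedRing.proj 𝒜 0 f ∈ p := (p.sub_mem_iff_right hf).1 hmem
  exact p.one_notMem (hu ▸ p.mul_mem_left u h0)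

theorem zero_le_ringKrullDim_quotient (p : Ideal R) [p.IsPrime] :
    ((0 : ℕ) : WithBot (WithTop ℕ)) ≤ ringKrullDim (R ⧸ p) := by
  exact ringKrullDim_nonneg_of_nontrivial (R := R ⧸ p)

variable [IsNoetherianRing R]

theorem exists_not_negAt_ext_ring {d : ℕ} (hdim : ringKrullDim R ≤ d) (p : Ideal R) [p.IsPrime]
    {c : ℕ} (hc : (c : WithBot (WithTop ℕ)) ≤ ringKrullDim (R ⧸ p)) :
    ∃ g : ℕ, g + c ≤ d ∧ ¬ NegAt p (X R (R ⧸ p) R g) := by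
  by_contra! h
  have hcd : c ≤ d := by
    have := hc.trans ((ringKrullDim_le_of_surjective _ (Ideal.Quotient.mk_surjective
      (I := p))).trans hdim)
    exact ENat.natCast_le_natCast.1 (WithBot.coe_le_coe.1 this)
  have hR : modDimLE (R := R) R d :=
    (ringKrullDim_le_of_surjective _ (Ideal.Quotient.mk_surjective
      (I := Module.annihilator R R))).trans hdim
  have h0 := negAt_ext_of_dim (W := R) p (d - c + 1) c (fun j hj => h j (by omega)) hc d R hR 0
    (by omega)
  exact NegAt.not_self_of_prime p
    ((NegAt.congr ((xZero R R).trans (LinearMap.ringLmapEquivSelf R R R))).1 h0)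

variable {W : Type} [AddCommGroup W] [Module R W] [Module.Finite R W]

theorem negAt_ext_of_homogeneousCore (hn : ∀ i : ℤ, i < 0 → 𝒜 i = ⊥) {nb : ℕ}
    (hnb : ∀ (A : Type) [AddCommGroup A] [Module R A] [Module.Finite R A] (j : ℕ),
      nb < j → Subsingleton (X R A W j)) {p : Ideal R} [p.IsPrime]
    (hp : ¬ p ≤ (p.homogeneousCore 𝒜).toIdeal) (hpm : ¬ p ≤ maxHomIdeal 𝒜) {g : ℕ}
    (hg : ¬ NegAt (p.homogeneousCore 𝒜).toIdeal
      (X R (R ⧸ (p.homogeneousCore 𝒜).toIdeal) R g)) (e : ℕ) :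
    ∀ (N : Type) [AddCommGroup N] [Module R N] [Module.Finite R N], Grading 𝒜 N →
      (∀ j < e, NegAt (p.homogeneousCore 𝒜).toIdeal
        (X R (R ⧸ (p.homogeneousCore 𝒜).toIdeal) N j)) →
      ∀ j, g < j + e → NegAt p (X R N W j) := by
  obtain ⟨f, hf, a, hfa, hfp, hdiv⟩ := exists_pseudo_generator hp
  obtain ⟨δ, hδ, z, hz, hzp⟩ := exists_homogeneous_pos_notMem hn hpm
  have hqh : (p.homogeneousCore 𝒜).toIdeal.IsHomogeneous 𝒜 := HomogeneousIdeal.isHomogeneous _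
  have hqp : (p.homogeneousCore 𝒜).toIdeal ≤ p := Ideal.toIdeal_homogeneousCore_le 𝒜 p
  have hqprime : (p.homogeneousCore 𝒜).toIdeal.IsPrime := Ideal.IsPrime.homogeneousCore ‹_›
  set q := (p.homogeneousCore 𝒜).toIdeal
  have hfq : f ∉ q := fun h => hfp (hqp (hqh a h))
  have hgp : ¬ NegAt p (X R (R ⧸ q) R g) := fun h => hg (h.mono hqp)
  have hgf : ¬ NegAt p (X R (QuotBy f (R ⧸ q)) R (g + 1)) := fun h =>
    hgp (NegAt.ext_left_of_quotBy hf
      (ker_mulBy_negAt (mulBy_quotient_injective hfq)) h)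
  have hgp' : ¬ NegAt p (X R (R ⧸ p) R (g + 1)) := fun h => by
    let r : QuotBy f (R ⧸ q) →ₗ[R] R ⧸ p := (LinearMap.range (mulBy f (R ⧸ q))).liftQ
      (Submodule.factor hqp) (by
        rintro _ ⟨x, rfl⟩
        obtain ⟨x, rfl⟩ := Ideal.Quotient.mk_surjective x
        change Ideal.Quotient.mk p (f * x) = 0
        exact Ideal.Quotient.eq_zero_iff_mem.2 (p.mul_mem_right x hf))
    have hr : Function.Surjective r := fun x => by
      obtain ⟨x, rfl⟩ := Ideal.Quotient.mk_surjective x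
      exact ⟨Submodule.Quotient.mk (Ideal.Quotient.mk q x), rfl⟩
    have hK : NegAt p (LinearMap.ker r) := NegAt.of_forall_elt fun x => by
      obtain ⟨x, hx⟩ := x
      obtain ⟨x, rfl⟩ := Submodule.Quotient.mk_surjective _ x
      obtain ⟨x, rfl⟩ := Ideal.Quotient.mk_surjective x
      obtain ⟨h, hh, c, hc⟩ := hdiv x (Ideal.Quotient.eq_zero_iff_mem.1 hx)
      refine ⟨h, hh, Subtype.ext ?_⟩
      refine (Submodule.Quotient.mk_eq_zero _).2 ⟨Ideal.Quotient.mk q c, ?_⟩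
      change Ideal.Quotient.mk q (f * c) = Ideal.Quotient.mk q (h * x)
      rw [mul_comm f c]
      exact (Ideal.Quotient.eq.2 hc).symm
    exact hgf (NegAt.of_exact (pre_exact R (g + 1) (SES.of_surjective r hr)) h
      (hK.ext_left R (g + 1)))
  have htop := negAt_ext_of_depth_ring p hnb hgp'
  induction e with
  | zero =>
    intro N _ _ _ G _ j hj
    refine NegAt.ext_left_of_quotBy hf (NegAt.of_forall_elt fun x => ?_)
      (htop (QuotBy f N) (j + 1) (by omega))
    obtain ⟨r, hr⟩ := G.exists_pow_smul_eq_zero hfa (x := (x : N)) x.2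
    exact ⟨_, fun h => hfp (‹p.IsPrime›.mem_of_pow_mem r h), Subtype.ext hr⟩
  | succ e ih =>
    intro N _ _ _ G hN j hj
    classical
    obtain ⟨b, y, hyb, hyq, hy⟩ := exists_homogeneous_avoid hn hqh hδ hz
      ((associatedPrimes.finite R N).toFinset.filter (· ≤ q)) fun P hP => by
        simp only [Finset.mem_filter, Set.Finite.mem_toFinset] at hP
        refine ⟨hP.1.isPrime, fun i x hx => G.proj_mem_of_associatedPrime hP.1 hx i,
          fun hqP => ?_, fun h => hzp (hqp (hP.2 h))⟩
        have hPq := le_antisymm hqP hP.2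
        exact NegAt.not_ext_zero_of_mem (hPq ▸ hP.1) (hN 0 (Nat.succ_pos e))
    have hker : NegAt q (LinearMap.ker (mulBy y N)) := NegAt.ker_of_avoid fun P hP hPq =>
      hy P (by simpa using ⟨hP, hPq⟩)
    refine NegAt.ext_left_of_quotBy (hqp hyq)
      (NegAt.of_homogeneousCore (G.submodule _ (G.proj_mem_ker_mulBy hyb)) hker)
      (ih (QuotBy y N) (G.quotient _ (G.proj_mem_range_mulBy hyb)) (fun l hl => ?_) (j + 1)
        (by omega))
    exact NegAt.ext_right_quotBy hker (hN l (by omega)) (hN (l + 1) (by omega))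

/-- Vanishing of `Ext` into a module of finite injective dimension, for graded modules. -/
theorem subsingleton_ext_of_grading (hn : ∀ i : ℤ, i < 0 → 𝒜 i = ⊥) [IsLocalRing (𝒜 0)]
    {d : ℕ} (hdim : ringKrullDim R ≤ d) {nb : ℕ}
    (hnb : ∀ (A : Type) [AddCommGroup A] [Module R A] [Module.Finite R A] (j : ℕ),
      nb < j → Subsingleton (X R A W j))
    {N : Type} [AddCommGroup N] [Module R N] [Module.Finite R N] (G : Grading 𝒜 N) {n : ℕ}
    (hN : ∀ j < n, NegAt (maxHomIdeal 𝒜) (X R (R ⧸ maxHomIdeal 𝒜) N j)) {i : ℕ}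
    (hi : d < i + n) : Subsingleton (X R N W i) := by
  have := maxHomIdeal_isMaximal hn
  refine NegAt.subsingleton_of_forall (R := R) fun p _ => ?_
  by_cases hpm : p ≤ maxHomIdeal 𝒜
  · obtain ⟨g, hgd, hg⟩ := exists_not_negAt_ext_ring hdim (maxHomIdeal 𝒜)
      (zero_le_ringKrullDim_quotient _)
    have h := negAt_ext_of_depth (maxHomIdeal 𝒜) (negAt_ext_of_depth_ring _ hnb hg) n N hN i
      (by omega)
    exact h.mono hpm
  have hqh : (p.homogeneousCore 𝒜).toIdeal.IsHomogeneous 𝒜 := HomogeneousIdeal.isHomogeneous _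
  have hqprime : (p.homogeneousCore 𝒜).toIdeal.IsPrime := Ideal.IsPrime.homogeneousCore ‹_›
  have hqm := le_maxHomIdeal hqh hqprime.ne_top
  obtain ⟨b, hb⟩ : ∃ b : ℕ, ringKrullDim (R ⧸ (p.homogeneousCore 𝒜).toIdeal) =
      (b : WithBot (WithTop ℕ)) := by
    have h1 : ringKrullDim (R ⧸ (p.homogeneousCore 𝒜).toIdeal) ≤ (d : WithBot (WithTop ℕ)) :=
      (ringKrullDim_le_of_surjective _ Ideal.Quotient.mk_surjective).trans hdim
    have h2 := zero_le_ringKrullDim_quotient (p.homogeneousCore 𝒜).toIdeal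
    obtain ⟨v, hv⟩ := WithBot.ne_bot_iff_exists.1
      (ne_bot_of_le_ne_bot (WithBot.coe_ne_bot (a := ((0 : ℕ) : WithTop ℕ))) h2)
    rw [← hv] at h1 ⊢
    obtain ⟨b, rfl⟩ := WithTop.ne_top_iff_exists.1
      (ne_top_of_le_ne_top (WithTop.natCast_ne_top d) (WithBot.coe_le_coe.1 h1))
    exact ⟨b, rfl⟩
  obtain ⟨g, hgd, hg⟩ := exists_not_negAt_ext_ring hdim (p.homogeneousCore 𝒜).toIdeal hb.ge
  refine negAt_ext_of_homogeneousCore hn hnb (fun h => hpm (h.trans hqm)) hpm hg (n - b) N G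
    (fun j hj => ?_) i (by omega)
  exact (negAt_ext_of_dim _ n 0 hN (zero_le_ringKrullDim_quotient _) b
    (R ⧸ (p.homogeneousCore 𝒜).toIdeal) ((modDimLE_quotient _).2 hb.le) j (by omega)).mono hqm

end GradedVanishing

section SocleEmbeddings

variable {A B X Y Z : Type} [AddCommGroup A] [Module R A] [AddCommGroup B] [Module R B]
  [AddCommGroup X] [Module R X] [AddCommGroup Y] [Module R Y] [AddCommGroup Z] [Module R Z]

/-- There is an injective linear map. -/
def Emb (R A B : Type) [CommRing R] [AddCommGroup A] [Module R A] [AddCommGroup B] [Module R B] :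
    Prop :=
  ∃ φ : A →ₗ[R] B, Function.Injective φ

theorem Emb.trans (h : Emb R A B) (h' : Emb R B X) : Emb R A X := by
  obtain ⟨f, hf⟩ := h
  obtain ⟨g, hg⟩ := h'
  exact ⟨g ∘ₗ f, hg.comp hf⟩

theorem injective_of_exact {f : A →ₗ[R] X} {g : X →ₗ[R] Y} (h : Function.Exact f g)
    [Subsingleton A] : Function.Injective g := by
  rw [← LinearMap.ker_eq_bot, h.linearMap_ker_eq, LinearMap.range_eq_bot]
  exact Subsingleton.elim _ _

theorem negAt_ker_of_exact {p : Ideal R} {f : A →ₗ[R] X} {g : X →ₗ[R] Y}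
    (h : Function.Exact f g) (hA : NegAt p A) : NegAt p (LinearMap.ker g) := by
  obtain ⟨s, hs, hA⟩ := hA
  refine ⟨s, hs, fun x => Subtype.ext ?_⟩
  obtain ⟨a, ha⟩ := (h x).1 x.2
  rw [Submodule.coe_smul, ← ha, ← map_smul, hA, map_zero, Submodule.coe_zero]

theorem negAt_coker_of_exact {p : Ideal R} {f : A →ₗ[R] X} {g : X →ₗ[R] Y}
    (h : Function.Exact f g) (hY : NegAt p Y) : NegAt p (X ⧸ LinearMap.range f) := by
  obtain ⟨s, hs, hY⟩ := hY
  refine ⟨s, hs, fun x => ?_⟩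
  obtain ⟨x, rfl⟩ := Submodule.Quotient.mk_surjective _ x
  refine (Submodule.Quotient.mk_eq_zero _).2 ((h _).1 ?_)
  rw [map_smul, hY]

variable {m : Ideal R}

/-- The map induced on socles. -/
def socleMap (m : Ideal R) (f : X →ₗ[R] Y) : socle m X →ₗ[R] socle m Y :=
  f.restrict fun x hx r hr => by rw [← map_smul, hx r hr, map_zero]

theorem emb_socle_of_injective {f : X →ₗ[R] Y} (hf : Function.Injective f) :
    Emb R (socle m X) (socle m Y) :=
  ⟨socleMap m f, fun _ _ h => Subtype.ext (hf (congrArg Subtype.val h))⟩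

theorem socleMap_injective [m.IsMaximal] {f : X →ₗ[R] Y} (hf : NegAt m (LinearMap.ker f)) :
    Function.Injective (socleMap m f) := by
  obtain ⟨s, hs, hf⟩ := hf
  rw [← LinearMap.ker_eq_bot, LinearMap.ker_eq_bot']
  rintro ⟨x, hx⟩ h
  obtain ⟨r, hr⟩ := Ideal.IsMaximal.exists_inv ‹_› hs
  obtain ⟨i, hi, h1⟩ := hr
  refine Subtype.ext ?_
  change x = 0
  have hsx : s • x = 0 := congrArg Subtype.val (hf ⟨x, congrArg Subtype.val h⟩)
  rw [← one_smul R x, ← h1, add_smul, mul_smul, hsx, smul_zero, hx i hi, zero_add]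

theorem socleMap_surjective [m.IsMaximal] {f : X →ₗ[R] Y} (hf : NegAt m (LinearMap.ker f))
    (hc : NegAt m (Y ⧸ LinearMap.range f)) : Function.Surjective (socleMap m f) := by
  obtain ⟨s, hs, hf⟩ := hf
  obtain ⟨u, hu, hc⟩ := hc
  rintro ⟨y, hy⟩
  obtain ⟨x, hx⟩ := (Submodule.Quotient.mk_eq_zero _).1 (hc (Submodule.Quotient.mk y))
  have hsu : s * u ∉ m := fun h =>
    ((inferInstance : m.IsPrime).mem_or_mem h).elim hs hu
  obtain ⟨r, i, hi, h1⟩ := Ideal.IsMaximal.exists_inv ‹_› hsu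
  refine ⟨⟨r • s • x, fun a ha => ?_⟩, Subtype.ext ?_⟩
  · have hk : f (a • x) = 0 := by
      rw [map_smul, hx, smul_comm, hy a ha, smul_zero]
    have : s • a • x = 0 := congrArg Subtype.val (hf ⟨a • x, hk⟩)
    rw [smul_comm a r, smul_comm a s, this, smul_zero]
  · change f (r • s • x) = y
    rw [map_smul, map_smul, hx]
    conv_rhs => rw [← one_smul R y, ← h1, add_smul, hy i hi, add_zero, mul_smul, mul_smul]

theorem emb_socle_of_exact [m.IsMaximal] {f : A →ₗ[R] X} {g : X →ₗ[R] Y}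
    (h : Function.Exact f g) (hA : NegAt m A) : Emb R (socle m X) (socle m Y) :=
  ⟨_, socleMap_injective (negAt_ker_of_exact h hA)⟩

theorem emb_socle_of_negAt [m.IsMaximal] {f : X →ₗ[R] Y} (hf : NegAt m (LinearMap.ker f))
    (hc : NegAt m (Y ⧸ LinearMap.range f)) : Emb R (socle m Y) (socle m X) :=
  ⟨(LinearEquiv.ofBijective (socleMap m f)
    ⟨socleMap_injective hf, socleMap_surjective hf hc⟩).symm.toLinearMap,
    LinearEquiv.injective _⟩

theorem emb_socle_of_exact_of_exact [m.IsMaximal] {f : A →ₗ[R] X} {g : X →ₗ[R] Y}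
    {h : Y →ₗ[R] Z} (hfg : Function.Exact f g) (hgh : Function.Exact g h) (hA : NegAt m A)
    (hZ : NegAt m Z) : Emb R (socle m Y) (socle m X) :=
  emb_socle_of_negAt (negAt_ker_of_exact hfg hA) (negAt_coker_of_exact hgh hZ)

theorem emb_socle_of_ker_eq [m.IsMaximal] {f : X →ₗ[R] Y} {g : X →ₗ[R] Z}
    (h : LinearMap.ker f = LinearMap.ker g) (hc : NegAt m (Y ⧸ LinearMap.range f)) :
    Emb R (socle m Y) (socle m Z) := by
  let f' := (LinearMap.ker f).liftQ f le_rfl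
  let g' := (LinearMap.ker f).liftQ g h.le
  have hf' : LinearMap.ker f' = ⊥ := Submodule.ker_liftQ_eq_bot _ _ _ le_rfl
  have hg' : LinearMap.ker g' = ⊥ := Submodule.ker_liftQ_eq_bot _ _ _ h.ge
  have hr : LinearMap.range f' = LinearMap.range f := Submodule.range_liftQ _ _ _
  refine (emb_socle_of_negAt (f := f') ?_ (by rwa [hr])).trans
    (emb_socle_of_injective (LinearMap.ker_eq_bot.1 hg'))
  rw [hf']
  exact NegAt.of_subsingleton m

theorem emb_socle_ext_zero (m : Ideal R) (N : Type) [AddCommGroup N] [Module R N] :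
    Emb R (socle m N) (Paper.X R (R ⧸ m) N 0) := by
  let φ : socle m N →ₗ[R] (R ⧸ m →ₗ[R] N) :=
    { toFun := fun x => Submodule.liftQ m (LinearMap.toSpanSingleton R N (x : N))
        fun r hr => by simpa using x.2 r hr
      map_add' := fun x y => by
        refine LinearMap.ext fun z => ?_
        obtain ⟨z, rfl⟩ := Ideal.Quotient.mk_surjective z
        exact smul_add z (x : N) y
      map_smul' := fun r x => by
        refine LinearMap.ext fun z => ?_
        obtain ⟨z, rfl⟩ := Ideal.Quotient.mk_surjective z
        exact smul_comm z r (x : N) }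
  refine ⟨(xZero (R ⧸ m) N).symm.toLinearMap ∘ₗ φ,
    (xZero (R ⧸ m) N).symm.injective.comp fun x y h => Subtype.ext ?_⟩
  have h1 : (1 : R) • (x : N) = (1 : R) • (y : N) :=
    LinearMap.congr_fun h (Ideal.Quotient.mk m 1)
  rwa [one_smul, one_smul] at h1

theorem subsingleton_of_socle {n : ℕ} (h : ∀ r ∈ m ^ n, ∀ x : X, r • x = 0)
    [hs : Subsingleton (socle m X)] : Subsingleton X := by
  induction n with
  | zero => exact subsingleton_of_forall_eq 0 fun x => by simpa using h 1 (by simp) x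
  | succ n ih =>
    refine ih fun r hr x => ?_
    have hx : r • x ∈ socle m X := fun a ha => by
      rw [smul_smul]
      exact h _ (by rw [pow_succ, mul_comm a]; exact Ideal.mul_mem_mul hr ha) x
    exact congrArg Subtype.val (Subsingleton.elim (⟨_, hx⟩ : socle m X) 0)

theorem exists_pow_smul_torsionSubmodule [IsNoetherianRing R] [Module.Finite R X] :
    ∃ n : ℕ, ∀ r ∈ m ^ n, ∀ x ∈ torsionSubmodule m X, r • x = 0 := by
  obtain ⟨S, hS⟩ := IsNoetherian.noetherian (torsionSubmodule m X)
  have hmem (x : X) (hx : x ∈ S) : ∃ t : ℕ, ∀ r ∈ m ^ t, r • x = 0 := by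
    have : x ∈ torsionSubmodule m X := hS ▸ Submodule.subset_span hx
    exact this
  choose t ht using hmem
  refine ⟨S.attach.sup fun x => t x x.2, fun r hr x hx => ?_⟩
  rw [← hS] at hx
  induction hx using Submodule.span_induction with
  | mem x hx =>
    exact ht x hx r (Ideal.pow_le_pow_right
      (Finset.le_sup (f := fun x : S => t x x.2) (Finset.mem_attach S ⟨x, hx⟩)) hr)
  | zero => exact smul_zero r
  | add a b _ _ ha hb => rw [smul_add, ha, hb, add_zero]
  | smul c a _ ha => rw [smul_comm, ha, smul_zero]

theorem modDimLE_zero_of_pow [m.IsMaximal] {n : ℕ} (h : ∀ r ∈ m ^ n, ∀ x : X, r • x = 0) :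
    modDimLE (R := R) X 0 := by
  refine (Ring.krullDimLE_iff (n := 0)).1 (Ring.krullDimLE_zero_iff.2 fun I hI => ?_)
  set J := I.comap (Ideal.Quotient.mk (Module.annihilator R X))
  have hmJ : m ≤ J := fun r hr => by
    refine (inferInstance : J.IsPrime).mem_of_pow_mem n ?_
    have : r ^ n ∈ Module.annihilator R X :=
      Module.mem_annihilator.2 (h _ (Ideal.pow_mem_pow hr n))
    change Ideal.Quotient.mk _ (r ^ n) ∈ I
    rw [Ideal.Quotient.eq_zero_iff_mem.2 this]
    exact I.zero_mem
  have hJ : m = J := Ideal.IsMaximal.eq_of_le ‹_› (inferInstance : J.IsPrime).ne_top hmJ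
  have : J.IsMaximal := hJ ▸ ‹m.IsMaximal›
  rw [← Ideal.map_comap_of_surjective _ Ideal.Quotient.mk_surjective I]
  refine (Ideal.map_eq_top_or_isMaximal_of_surjective _ Ideal.Quotient.mk_surjective
    this).resolve_left ?_
  rw [Ideal.map_comap_of_surjective _ Ideal.Quotient.mk_surjective I]
  exact hI.ne_top

end SocleEmbeddings

section DualComplex

variable {C : ℕ → Type} [∀ j, AddCommGroup (C j)] [∀ j, Module R (C j)]
  (dl : ∀ j, C (j + 1) →ₗ[R] C j)

/-- The cokernel of a differential. -/
abbrev Coker (b : ℕ) : Type := C b ⧸ LinearMap.range (dl b)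

/-- The inclusion of the homology into the cokernel. -/
def homologyToCoker (b : ℕ) : Hmod C dl b →ₗ[R] Coker dl (b + 1) :=
  Submodule.mapQ _ _ (LinearMap.ker (dl b)).subtype le_rfl

variable {dl} in
/-- The map from the cokernel to the boundaries. -/
def cokerToRange (hcomplex : ∀ j, (dl j).comp (dl (j + 1)) = 0) (b : ℕ) :
    Coker dl (b + 1) →ₗ[R] LinearMap.range (dl b) :=
  (LinearMap.range (dl (b + 1))).liftQ (dl b).rangeRestrict (by
    rintro _ ⟨x, rfl⟩
    exact Subtype.ext (LinearMap.congr_fun (hcomplex b) x))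

variable {dl}

theorem ses_homology (hcomplex : ∀ j, (dl j).comp (dl (j + 1)) = 0) (b : ℕ) :
    SES (homologyToCoker dl b) (cokerToRange hcomplex b) where
  inj := by
    rw [← LinearMap.ker_eq_bot, LinearMap.ker_eq_bot']
    intro x hx
    obtain ⟨x, rfl⟩ := Submodule.Quotient.mk_surjective _ x
    exact (Submodule.Quotient.mk_eq_zero _).2
      ((Submodule.Quotient.mk_eq_zero (LinearMap.range (dl (b + 1)))).1 hx)
  exact x := by
    obtain ⟨x, rfl⟩ := Submodule.Quotient.mk_surjective _ x
    constructor
    · intro hx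
      exact ⟨Submodule.Quotient.mk ⟨x, congrArg Subtype.val hx⟩, rfl⟩
    · rintro ⟨y, hy⟩
      obtain ⟨y, rfl⟩ := Submodule.Quotient.mk_surjective _ y
      rw [← hy]
      exact Subtype.ext y.2
  surj := by
    rintro ⟨_, x, rfl⟩
    exact ⟨Submodule.Quotient.mk x, rfl⟩

variable (dl) (ω : Type) [AddCommGroup ω] [Module R ω]

/-- The cocycles of the dual complex. -/
abbrev dualKer (b : ℕ) : Submodule R (C (b + 1) →ₗ[R] ω) :=
  LinearMap.ker (LinearMap.lcomp R ω (dl (b + 1)))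

/-- The coboundaries of the dual complex. -/
abbrev dualRange (b : ℕ) : Submodule R (C (b + 1) →ₗ[R] ω) :=
  LinearMap.range (LinearMap.lcomp R ω (dl b))

/-- The cohomology of the dual complex. -/
abbrev dualHomology (b : ℕ) : Type :=
  dualKer dl ω b ⧸ (dualRange dl ω b).comap (dualKer dl ω b).subtype

variable {dl}

theorem dualRange_le_dualKer (hcomplex : ∀ j, (dl j).comp (dl (j + 1)) = 0) (b : ℕ) :
    dualRange dl ω b ≤ dualKer dl ω b := by
  rintro _ ⟨f, rfl⟩
  refine LinearMap.ext fun x => ?_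
  change f (dl b (dl (b + 1) x)) = 0
  rw [show dl b (dl (b + 1) x) = 0 from LinearMap.congr_fun (hcomplex b) x, map_zero]

theorem ses_dualHomology (hcomplex : ∀ j, (dl j).comp (dl (j + 1)) = 0) (b : ℕ) :
    SES (Submodule.inclusion (dualRange_le_dualKer ω hcomplex b))
      ((dualRange dl ω b).comap (dualKer dl ω b).subtype).mkQ where
  inj := Submodule.inclusion_injective _
  exact := by
    rw [LinearMap.exact_iff, Submodule.ker_mkQ, Submodule.range_inclusion]
  surj := Submodule.mkQ_surjective _

/-- Functionals on the boundaries, as cocycles of the dual complex. -/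
def rangeDualToDualKer (hcomplex : ∀ j, (dl j).comp (dl (j + 1)) = 0) (b : ℕ) :
    (LinearMap.range (dl b) →ₗ[R] ω) →ₗ[R] dualKer dl ω b :=
  (LinearMap.lcomp R ω (dl b).rangeRestrict).codRestrict _ fun f => by
    refine LinearMap.ext fun x => ?_
    change f ((dl b).rangeRestrict (dl (b + 1) x)) = 0
    rw [show (dl b).rangeRestrict (dl (b + 1) x) = 0 from
      Subtype.ext (LinearMap.congr_fun (hcomplex b) x), map_zero]

theorem rangeDualToDualKer_mem_iff (hcomplex : ∀ j, (dl j).comp (dl (j + 1)) = 0) (b : ℕ)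
    (f : LinearMap.range (dl b) →ₗ[R] ω) :
    (rangeDualToDualKer ω hcomplex b f : C (b + 1) →ₗ[R] ω) ∈ dualRange dl ω b ↔
      f ∈ LinearMap.range (LinearMap.lcomp R ω (LinearMap.range (dl b)).subtype) := by
  constructor
  · rintro ⟨g, hg⟩
    refine ⟨g, LinearMap.ext ?_⟩
    rintro ⟨_, x, rfl⟩
    exact LinearMap.congr_fun hg x
  · rintro ⟨g, rfl⟩
    exact ⟨g, rfl⟩

variable {ω} {m : Ideal R}

theorem exists_smul_mem_range (hcomplex : ∀ j, (dl j).comp (dl (j + 1)) = 0) (b : ℕ)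
    (h : NegAt m (X R (Hmod C dl b) ω 0)) :
    ∃ s ∉ m, ∀ f, s • f ∈ LinearMap.range (rangeDualToDualKer ω hcomplex b) := by
  obtain ⟨s, hs, h⟩ := (NegAt.congr (xZero _ _)).1 h
  refine ⟨s, hs, fun f => ?_⟩
  have hf : ∀ x, f.1 (dl (b + 1) x) = 0 := fun x => LinearMap.congr_fun f.2 x
  let g : Hmod C dl b →ₗ[R] ω := Submodule.liftQ _
    (f.1 ∘ₗ (LinearMap.ker (dl b)).subtype) (by
      rintro ⟨_, hx⟩ ⟨x, rfl⟩
      exact hf x)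
  have hker : LinearMap.ker (dl b).rangeRestrict ≤ LinearMap.ker (s • f.1) := fun x hx => by
    have hx' : dl b x = 0 := congrArg Subtype.val hx
    exact LinearMap.congr_fun (h g) (Submodule.Quotient.mk ⟨x, hx'⟩)
  let e := (dl b).rangeRestrict.quotKerEquivOfSurjective (dl b).surjective_rangeRestrict
  refine ⟨(LinearMap.ker (dl b).rangeRestrict).liftQ (s • f.1) hker ∘ₗ e.symm.toLinearMap,
    Subtype.ext (LinearMap.ext fun x => ?_)⟩
  change Submodule.liftQ _ (s • f.1) hker (e.symm ((dl b).rangeRestrict x)) = (s • f.1) x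
  have : e.symm ((dl b).rangeRestrict x) = Submodule.Quotient.mk x :=
    (LinearEquiv.symm_apply_eq _).2 rfl
  rw [this]
  rfl

variable (b : ℕ)

/-- The connecting map on functionals. -/
def rangeDualToExt (ω : Type) [AddCommGroup ω] [Module R ω] (b : ℕ) :
    (LinearMap.range (dl b) →ₗ[R] ω) →ₗ[R] X R (Coker dl b) ω 1 :=
  preδ (SES.of_submodule (LinearMap.range (dl b))) ω 0 ∘ₗ (xZero _ _).symm.toLinearMap

theorem ker_rangeDualToExt : LinearMap.ker (rangeDualToExt (dl := dl) ω b) =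
    LinearMap.range (LinearMap.lcomp R ω (LinearMap.range (dl b)).subtype) := by
  ext f
  have h := pre_exact_δ ω 0 (SES.of_submodule (LinearMap.range (dl b)))
    ((xZero _ _).symm f)
  refine h.trans ⟨?_, ?_⟩
  · rintro ⟨y, hy⟩
    refine ⟨xZero _ _ y, ?_⟩
    have := xZero_pre (LinearMap.range (dl b)).subtype y
    rw [hy, LinearEquiv.apply_symm_apply] at this
    exact this.symm
  · rintro ⟨y, rfl⟩
    refine ⟨(xZero _ _).symm y, (xZero _ _).injective ?_⟩
    rw [xZero_pre, LinearEquiv.apply_symm_apply, LinearEquiv.apply_symm_apply]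
    rfl

theorem negAt_coker_rangeDualToExt (hC : NegAt m (X R (C b) ω 1)) :
    NegAt m (X R (Coker dl b) ω 1 ⧸ LinearMap.range (rangeDualToExt (dl := dl) ω b)) := by
  have h := negAt_coker_of_exact
    (preδ_exact ω 0 (SES.of_submodule (LinearMap.range (dl b)))) hC
  rwa [rangeDualToExt, LinearMap.range_comp, LinearEquiv.range, Submodule.map_top]

theorem negAt_dualHomology [m.IsMaximal] (hcomplex : ∀ j, (dl j).comp (dl (j + 1)) = 0)
    (hH : NegAt m (X R (Hmod C dl b) ω 0))
    (hQ : NegAt m (X R (Coker dl b) ω 1)) : NegAt m (dualHomology dl ω b) := by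
  obtain ⟨s, hs, h⟩ := exists_smul_mem_range hcomplex b hH
  obtain ⟨u, hu, hQ⟩ := hQ
  refine ⟨u * s, fun hus => ((inferInstance : m.IsPrime).mem_or_mem hus).elim hu hs,
    fun f => ?_⟩
  obtain ⟨f, rfl⟩ := Submodule.Quotient.mk_surjective _ f
  obtain ⟨g, hg⟩ := h f
  refine (Submodule.Quotient.mk_eq_zero _).2 ?_
  have hug : (u * s) • f = rangeDualToDualKer ω hcomplex b (u • g) := by
    rw [map_smul, hg, mul_smul]
  change ((u * s) • f).1 ∈ dualRange dl ω b
  rw [hug]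
  rw [rangeDualToDualKer_mem_iff, ← ker_rangeDualToExt, LinearMap.mem_ker, map_smul, hQ]

theorem emb_socle_dualHomology [m.IsMaximal]
    (hcomplex : ∀ j, (dl j).comp (dl (j + 1)) = 0) (hC : NegAt m (X R (C b) ω 1)) :
    Emb R (socle m (X R (Coker dl b) ω 1)) (socle m (dualHomology dl ω b)) := by
  refine emb_socle_of_ker_eq (f := rangeDualToExt ω b)
    (g := Submodule.mkQ _ ∘ₗ rangeDualToDualKer ω hcomplex b) ?_
    (negAt_coker_rangeDualToExt b hC)
  rw [ker_rangeDualToExt]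
  ext f
  rw [← rangeDualToDualKer_mem_iff ω hcomplex, LinearMap.mem_ker, LinearMap.comp_apply,
    Submodule.mkQ_apply, Submodule.Quotient.mk_eq_zero]
  rfl

end DualComplex

section Chains

variable {C : ℕ → Type} [∀ j, AddCommGroup (C j)] [∀ j, Module R (C j)]
  {dl : ∀ j, C (j + 1) →ₗ[R] C j} {ω : Type} [AddCommGroup ω] [Module R ω]
  {m : Ideal R} {i t : ℕ}

theorem negAt_ext_coker [m.IsPrime] (hcomplex : ∀ j, (dl j).comp (dl (j + 1)) = 0)
    (hC : ∀ j q, j < i → 1 ≤ q → i ≤ q + t + j → NegAt m (X R (C j) ω q))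
    (hH : ∀ j q, q + (j + 1) < i → NegAt m (X R (Hmod C dl j) ω q))
    (h0 : ∀ n, i < n + t → n < i → NegAt m (X R (Coker dl 0) ω n)) (b : ℕ) :
    ∀ a, 1 ≤ a → i < a + b + t → a + b < i → NegAt m (X R (Coker dl b) ω a) := by
  induction b with
  | zero => intro a _ h h'; exact h0 a h h'
  | succ b ih =>
    intro a ha h h'
    have hB : NegAt m (X R (LinearMap.range (dl b)) ω a) :=
      NegAt.of_exact (pre_exact_δ ω a (SES.of_submodule (LinearMap.range (dl b))))
        (hC b a (by omega) ha (by omega)) (ih (a + 1) (by omega) (by omega) (by omega))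
    exact NegAt.of_exact (pre_exact ω a (ses_homology hcomplex b)) hB (hH b a (by omega))

theorem emb_socle_ext_coker [m.IsMaximal] (hcomplex : ∀ j, (dl j).comp (dl (j + 1)) = 0)
    (ht : 1 ≤ t)
    (hC : ∀ j q, j < i → 1 ≤ q → i ≤ q + t + j → NegAt m (X R (C j) ω q))
    (hH : ∀ j q, q + (j + 1) < i → NegAt m (X R (Hmod C dl j) ω q)) (b : ℕ) :
    ∀ a, 1 ≤ a → a + b = i →
      Emb R (socle m (X R (Coker dl 0) ω i)) (socle m (X R (Coker dl b) ω a)) := by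
  induction b with
  | zero => rintro a _ rfl; exact ⟨LinearMap.id, Function.injective_id⟩
  | succ b ih =>
    intro a ha h
    obtain ⟨a, rfl⟩ := Nat.exists_eq_add_of_le' ha
    refine (ih (a + 2) (by omega) (by omega)).trans (Emb.trans ?_
      (emb_socle_of_exact (preδ_exact ω a (ses_homology hcomplex b)) (hH b a (by omega))))
    exact emb_socle_of_exact_of_exact
      (pre_exact_δ ω (a + 1) (SES.of_submodule (LinearMap.range (dl b))))
      (preδ_exact ω (a + 1) (SES.of_submodule (LinearMap.range (dl b))))
      (hC b (a + 1) (by omega) ha (by omega)) (hC b (a + 2) (by omega) (by omega) (by omega))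

/-- Negligible cohomology of the dual complex identifies the higher `Ext` groups of the
coboundaries and of the cocycles. -/
theorem nonempty_ext_dualKer_equiv [m.IsMaximal]
    (hcomplex : ∀ j, (dl j).comp (dl (j + 1)) = 0) {b : ℕ} (s : ℕ)
    (hH : NegAt m (dualHomology dl ω b)) :
    Nonempty (X R (R ⧸ m) (dualKer dl ω b) (s + 1) ≃ₗ[R]
      X R (R ⧸ m) (dualRange dl ω b) (s + 1)) := by
  have := (hH.ext_right (R ⧸ m) s).subsingleton_ext
  have := (hH.ext_right (R ⧸ m) (s + 1)).subsingleton_ext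
  exact ⟨(LinearEquiv.ofBijective _
    ⟨injective_of_exact (postδ_exact (R ⧸ m) s (ses_dualHomology ω hcomplex b)), fun x =>
      (post_exact (R ⧸ m) (s + 1) (ses_dualHomology ω hcomplex b) x).1
        (Subsingleton.elim _ _)⟩).symm⟩

theorem emb_ext_dualRange_succ [m.IsMaximal] (hcomplex : ∀ j, (dl j).comp (dl (j + 1)) = 0)
    {b s : ℕ} (hC : NegAt m (X R (R ⧸ m) (C (b + 1) →ₗ[R] ω) s))
    (hH : NegAt m (dualHomology dl ω b)) :
    Emb R (X R (R ⧸ m) (dualRange dl ω (b + 1)) s)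
      (X R (R ⧸ m) (dualRange dl ω b) (s + 1)) := by
  have := hC.subsingleton_ext
  obtain ⟨e⟩ := nonempty_ext_dualKer_equiv hcomplex s hH
  exact Emb.trans ⟨_, injective_of_exact (post_exact_δ (R ⧸ m) s
    (ses_ker_range (LinearMap.lcomp R ω (dl (b + 1)))))⟩ ⟨e.toLinearMap, e.injective⟩

theorem emb_socle_ext_dualRange [m.IsMaximal] {E : Type} [AddCommGroup E] [Module R E]
    (hcomplex : ∀ j, (dl j).comp (dl (j + 1)) = 0)
    (hC : ∀ j s, i < j + t → j ≤ i → s ≤ i - j →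
      NegAt m (X R (R ⧸ m) (C j →ₗ[R] ω) s))
    (hH : ∀ b, i < b + 1 + t → b + 1 < i → NegAt m (dualHomology dl ω b))
    (hi : ∀ b, b + 1 = i → Emb R E (X R (R ⧸ m) (dualRange dl ω b) 1)) (s : ℕ) :
    ∀ b, s + 1 ≤ t → b + (s + 1) = i →
      Emb R E (X R (R ⧸ m) (dualRange dl ω b) (s + 1)) := by
  induction s with
  | zero => intro b _ hb; exact hi b hb
  | succ s ih =>
    intro b hs hb
    exact (ih (b + 1) (by omega) (by omega)).trans
      (emb_ext_dualRange_succ hcomplex (hC _ _ (by omega) (by omega) (by omega))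
        (hH b (by omega) (by omega)))

theorem subsingleton_ext_dualRange [m.IsMaximal]
    (hcomplex : ∀ j, (dl j).comp (dl (j + 1)) = 0)
    (hC : ∀ j s, i < j + t → j ≤ i → s ≤ i - j →
      NegAt m (X R (R ⧸ m) (C j →ₗ[R] ω) s))
    (hH : ∀ b, i < b + 1 + t → b + 1 < i → NegAt m (dualHomology dl ω b)) (s : ℕ) :
    ∀ b, i ≤ b + t → b + s < i → Subsingleton (X R (R ⧸ m) (dualRange dl ω b) s) := by
  induction s with
  | zero =>
    intro b hb hs
    have := (hC (b + 1) 0 (by omega) (by omega) (by omega)).subsingleton_ext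
    exact (post_zero_injective (R ⧸ m) (dualRange dl ω b).injective_subtype).subsingleton
  | succ s ih =>
    intro b hb hs
    have := ih (b + 1) (by omega) (by omega)
    have := (hC (b + 1) (s + 1) (by omega) (by omega) (by omega)).subsingleton_ext
    obtain ⟨e⟩ := nonempty_ext_dualKer_equiv hcomplex s (hH b (by omega) (by omega))
    have := (injective_of_exact (postδ_exact (R ⧸ m) s
      (ses_ker_range (LinearMap.lcomp R ω (dl (b + 1)))))).subsingleton
    exact e.symm.injective.subsingleton

theorem emb_socle_dualHomology_ext [m.IsMaximal]
    (hcomplex : ∀ j, (dl j).comp (dl (j + 1)) = 0) {b : ℕ}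
    (hC : NegAt m (X R (R ⧸ m) (C (b + 1) →ₗ[R] ω) 0)) :
    Emb R (socle m (dualHomology dl ω b)) (X R (R ⧸ m) (dualRange dl ω b) 1) := by
  have := hC.subsingleton_ext
  have : Subsingleton (X R (R ⧸ m) (dualKer dl ω b) 0) :=
    (post_zero_injective (R ⧸ m) (dualKer dl ω b).injective_subtype).subsingleton
  exact (emb_socle_ext_zero m _).trans ⟨_, injective_of_exact
    (post_exact_δ (R ⧸ m) 0 (ses_dualHomology ω hcomplex b))⟩

end Chains

section Main

variable {ω : Type} [AddCommGroup ω] [Module R ω]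

theorem exists_subsingleton_ext (h : injDimFinite R ω) :
    ∃ nb : ℕ, ∀ (A : Type) [AddCommGroup A] [Module R A] [Module.Finite R A] (j : ℕ), nb < j →
      Subsingleton (X R A ω j) := by
  obtain ⟨nb, h⟩ := h
  refine ⟨nb, fun A _ _ _ j hj => ?_⟩
  obtain ⟨j, rfl⟩ := Nat.exists_eq_add_of_le' (Nat.one_le_of_lt hj)
  have := h A _ hj
  exact (extModuleEquiv A ω j).symm.injective.subsingleton

variable [IsNoetherianRing R]

theorem finite_linearMap (A B : Type) [AddCommGroup A] [Module R A] [AddCommGroup B] [Module R B]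
    [Module.Finite R A] [Module.Finite R B] : Module.Finite R (A →ₗ[R] B) :=
  have := x_finite (R := R) (A := A) (B := B) 0
  Module.Finite.equiv (xZero A B)

theorem negAt_ext_torsionSubmodule [Module.Finite R ω] {m : Ideal R} [m.IsMaximal] {d : ℕ}
    (hω : ∀ j < d, NegAt m (X R (R ⧸ m) ω j)) (M : Type) [AddCommGroup M] [Module R M]
    [Module.Finite R M] {j : ℕ} (hj : j < d) : NegAt m (X R (torsionSubmodule m M) ω j) := by
  obtain ⟨n, hn⟩ := exists_pow_smul_torsionSubmodule (m := m) (X := M)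
  exact negAt_ext_of_dim m d 0 hω (zero_le_ringKrullDim_quotient m) 0 _
    (modDimLE_zero_of_pow fun r hr x => Subtype.ext (hn r hr x x.2)) j (by omega)

theorem exists_pow_smul_ext {m : Ideal R} (M : Type) [AddCommGroup M] [Module R M]
    [Module.Finite R M] {j : ℕ}
    (h : Subsingleton (X R (M ⧸ torsionSubmodule m M) ω j)) :
    ∃ n : ℕ, ∀ r ∈ m ^ n, ∀ x : X R M ω j, r • x = 0 := by
  obtain ⟨n, hn⟩ := exists_pow_smul_torsionSubmodule (m := m) (X := M)
  refine ⟨n, fun r hr x => injective_of_exact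
    (pre_exact ω j (SES.of_submodule (torsionSubmodule m M))) ?_⟩
  have h0 : r • (torsionSubmodule m M).subtype = 0 :=
    LinearMap.ext fun x => hn r hr x x.2
  rw [map_zero, map_smul, ← LinearMap.smul_apply]
  rw [← pre_smul, h0, pre_zero, LinearMap.zero_apply]

theorem subsingleton_range_lcomp {𝒜 : ℤ → AddSubgroup R} [GradedRing 𝒜]
    (hn : ∀ i : ℤ, i < 0 → 𝒜 i = ⊥) [IsLocalRing (𝒜 0)] {d : ℕ} (hdim : ringKrullDim R ≤ d)
    [Module.Finite R ω]
    (hω : ∀ j < d, NegAt (maxHomIdeal 𝒜) (X R (R ⧸ maxHomIdeal 𝒜) ω j))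
    (hωd : ¬ NegAt (maxHomIdeal 𝒜) (X R (R ⧸ maxHomIdeal 𝒜) ω d))
    (htop : ∀ (A : Type) [AddCommGroup A] [Module R A] [Module.Finite R A] (j : ℕ), d < j →
      NegAt (maxHomIdeal 𝒜) (X R A ω j))
    (hR : ∀ j < d, NegAt (maxHomIdeal 𝒜) (X R (R ⧸ maxHomIdeal 𝒜) R j))
    {A B : Type} [AddCommGroup A] [Module R A] [AddCommGroup B] [Module R B] [Module.Finite R B]
    (hB : ∀ j < d, NegAt (maxHomIdeal 𝒜) (X R (R ⧸ maxHomIdeal 𝒜) B j))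
    (G : Grading 𝒜 B) (f : A →ₗ[R] B)
    (hf : ∀ j, ∀ x ∈ LinearMap.range f, G.proj j x ∈ LinearMap.range f)
    (h : NegAt (maxHomIdeal 𝒜) (LinearMap.range (LinearMap.lcomp R ω f))) :
    Subsingleton (LinearMap.range (LinearMap.lcomp R ω f)) := by
  have := maxHomIdeal_isMaximal hn
  have hdimLE (N : Type) [AddCommGroup N] [Module R N] : modDimLE (R := R) N d :=
    (ringKrullDim_le_of_surjective _ Ideal.Quotient.mk_surjective).trans hdim
  obtain ⟨s, hs, h⟩ := h
  have hx (x : LinearMap.range f) : ∃ u ∉ maxHomIdeal 𝒜, u • x = 0 := by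
    obtain ⟨_, x, rfl⟩ := x
    have key := negAt_range_of_pre hω hωd htop d 0 R B (LinearMap.toSpanSingleton R B (f x))
      (zero_add d) hR hB (hdimLE R) (hdimLE B) ⟨s, hs, by
        rintro ⟨_, y, rfl⟩
        refine Subtype.ext ((xZero R ω).injective (LinearMap.ext_ring ?_))
        have h1 := congrArg Subtype.val (h ⟨_, xZero B ω y, rfl⟩)
        have h2 : s • xZero B ω y (f x) = 0 := LinearMap.congr_fun h1 x
        simpa [xZero_pre] using h2⟩
    obtain ⟨u, hu, hu'⟩ := key
    refine ⟨u, hu, Subtype.ext ?_⟩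
    simpa using congrArg Subtype.val (hu' ⟨_, 1, rfl⟩)
  have : Subsingleton (LinearMap.range f) :=
    (G.submodule _ hf).subsingleton_of_negAt (NegAt.of_forall_elt hx)
  have hf0 : f = 0 := LinearMap.ext fun x =>
    congrArg Subtype.val (Subsingleton.elim (f.rangeRestrict x) 0)
  refine subsingleton_of_forall_eq 0 ?_
  rintro ⟨_, g, rfl⟩
  refine Subtype.ext (LinearMap.ext fun x => ?_)
  simp [hf0]

end Main

theorem statement4
    (𝒜 : ℤ → AddSubgroup R) [GradedRing 𝒜]
    (hNoeth : IsNoetherianRing R)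
    (hnonneg : ∀ i : ℤ, i < 0 → 𝒜 i = ⊥)
    -- `R₀` is a Cohen–Macaulay factor ring of a local Gorenstein ring
    (hloc : IsLocalRing ↥(𝒜 0))
    (hR0 : IsCMLocal ↥(𝒜 0) ∧ ∃ (S₀ : Type) (_ : CommRing S₀),
      IsGorensteinLocal S₀ ∧ ∃ φ : S₀ →+* ↥(𝒜 0), Function.Surjective φ)
    -- `R` is Cohen–Macaulay with `dim R = d`
    (d : ℕ) (hdim : ringKrullDim R = (d : WithBot (WithTop ℕ)))
    (hCM : depthGE (maxHomIdeal 𝒜) R d)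
    -- `ω = ω_R` is the canonical module
    (ω : Type) [AddCommGroup ω] [Module R ω]
    (hω : IsCanonicalModule (maxHomIdeal 𝒜) d ω)
    -- `(C_•, ∂_•)` a graded complex of finitely generated graded modules, `M = H₀(C_•)`
    (M : Type) [AddCommGroup M] [Module R M]
    (ℳ : ℤ → AddSubgroup M) [DirectSum.Decomposition ℳ] [SetLike.GradedSMul 𝒜 ℳ]
    (C : ℕ → Type) [∀ j, AddCommGroup (C j)] [∀ j, Module R (C j)]
    (hCfin : ∀ j, Module.Finite R (C j))
    (dl : ∀ j, C (j + 1) →ₗ[R] C j)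
    (hcomplex : ∀ j, (dl j).comp (dl (j + 1)) = 0)
    (𝒞 : ∀ j, ℤ → AddSubgroup (C j))
    [∀ j, DirectSum.Decomposition (𝒞 j)] [∀ j, SetLike.GradedSMul 𝒜 (𝒞 j)]
    (hdlhomog : ∀ (j : ℕ) (ℓ : ℤ), ∀ x ∈ 𝒞 (j + 1) ℓ, dl j x ∈ 𝒞 j ℓ)
    (π : C 0 →ₗ[R] M) (hπsurj : Function.Surjective π)
    (hπker : LinearMap.ker π = LinearMap.range (dl 0))
    (hπhomog : ∀ (ℓ : ℤ), ∀ x ∈ 𝒞 0 ℓ, π x ∈ ℳ ℓ)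
    -- `1 ≤ t ≤ i ≤ d`
    (i t : ℕ) (ht1 : 1 ≤ t) (hti : t ≤ i) (hid : i ≤ d)
    -- hypothesis (1): `d - i + t ≤ depth M/H⁰_𝔪(M)`
    (h1 : depthGE (maxHomIdeal 𝒜)
      (M ⧸ torsionSubmodule (maxHomIdeal 𝒜) M) (d - i + t))
    -- hypothesis (2): `dim H_j(C_•) ≤ d - i + j` for `1 ≤ j ≤ i - 1`
    (h2 : ∀ jm1 : ℕ, ((jm1 + 1 : ℕ) : ℤ) ≤ (i : ℤ) - 1 →
      modDimLE (R := R) (Hmod C dl jm1) (d - i + (jm1 + 1)))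
    -- hypothesis (3): `min{d, d - i + t + j + 1} ≤ depth C_j` for `0 ≤ j ≤ i - 1`
    (h3 : ∀ j : ℕ, (j : ℤ) ≤ (i : ℤ) - 1 →
      depthGE (maxHomIdeal 𝒜) (C j) (min d (d - i + t + j + 1)))
    -- hypothesis (4): `i - j + 1 ≤ depth C_j^∨` for `i - t + 1 ≤ j ≤ i`
    (h4 : ∀ j : ℕ, i - t + 1 ≤ j → j ≤ i →
      depthGE (maxHomIdeal 𝒜) (C j →ₗ[R] ω) (i - j + 1)) :
    -- conclusion: a natural homogeneous injection
    --   `socle(Ext^i_R(M, ω)) ↪ Ext^t_R(k, im ∂^∨_{i-t+1})`,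
    -- where `∂^∨_{i-t+1} = Hom(∂_{i-t+1}, ω) : Hom(C_{i-t}, ω) → Hom(C_{i-t+1}, ω)`
    (∃ φ : ↥(socle (maxHomIdeal 𝒜) (extModule R M ω i)) →ₗ[R]
        extModule R (R ⧸ maxHomIdeal 𝒜)
          ↥(LinearMap.range (LinearMap.lcomp R ω (dl (i - t)))) t,
      Function.Injective φ)
    -- moreover `t ≤ depth (im ∂^∨_{i-t+1})` …
    ∧ depthGE (maxHomIdeal 𝒜)
        ↥(LinearMap.range (LinearMap.lcomp R ω (dl (i - t)))) t
    -- … with equality if `depth Ext^i_R(M, ω) = 0`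
    ∧ ((Nontrivial (extModule R M ω i) ∧
          ¬ depthGE (maxHomIdeal 𝒜) (extModule R M ω i) 1) →
        ¬ depthGE (maxHomIdeal 𝒜)
          ↥(LinearMap.range (LinearMap.lcomp R ω (dl (i - t)))) (t + 1)) := by
  have hmax := maxHomIdeal_isMaximal hnonneg
  obtain ⟨hωfin, hωdepth, ⟨eω⟩, hωinj⟩ := hω
  obtain ⟨nb, hnb⟩ := exists_subsingleton_ext hωinj
  have hMfin : Module.Finite R M := Module.Finite.of_surjective π hπsurj
  have hHfin (j : ℕ) : Module.Finite R (Hmod C dl j) := inferInstance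
  have hdual (j : ℕ) : Module.Finite R (C j →ₗ[R] ω) := finite_linearMap _ _
  obtain ⟨i, rfl⟩ := Nat.exists_eq_add_of_le' (ht1.trans hti)
  obtain ⟨t, rfl⟩ := Nat.exists_eq_add_of_le' ht1
  obtain ⟨d, rfl⟩ := Nat.exists_eq_add_of_le' ((ht1.trans hti).trans hid)
  have hω (j : ℕ) (hj : j < d + 1) : NegAt (maxHomIdeal 𝒜) (X R (R ⧸ maxHomIdeal 𝒜) ω j) :=
    negAt_ext_of_depthGE hωdepth hj
  have hωd : ¬ NegAt (maxHomIdeal 𝒜) (X R (R ⧸ maxHomIdeal 𝒜) ω (d + 1)) := fun h => by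
    obtain ⟨s, hs, h⟩ := h.of_equiv ((extModuleEquiv _ ω d).symm.trans eω)
    refine hs (Ideal.Quotient.eq_zero_iff_mem.1 ?_)
    have := h 1
    rwa [Algebra.smul_def, mul_one] at this
  obtain ⟨g, hgd, hg⟩ := exists_not_negAt_ext_ring hdim.le (maxHomIdeal 𝒜)
    (zero_le_ringKrullDim_quotient _)
  have htop (A : Type) [AddCommGroup A] [Module R A] [Module.Finite R A] (j : ℕ)
      (hj : d + 1 < j) : NegAt (maxHomIdeal 𝒜) (X R A ω j) :=
    negAt_ext_of_depth_ring _ hnb hg A j (by omega)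
  have hC (j q : ℕ) (hj : j < i + 1) (hq : 1 ≤ q) (hjq : i + 1 ≤ q + (t + 1) + j) :
      NegAt (maxHomIdeal 𝒜) (X R (C j) ω q) :=
    negAt_ext_of_depth _ htop _ (C j)
      (fun _ => negAt_ext_of_depthGE (h3 j (by omega))) q (by omega)
  have hH (j q : ℕ) (hjq : q + (j + 1) < i + 1) :
      NegAt (maxHomIdeal 𝒜) (X R (Hmod C dl j) ω q) :=
    negAt_ext_of_dim _ (d + 1) 0 hω (zero_le_ringKrullDim_quotient _) _ _
      (h2 j (by omega)) q (by omega)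
  have hMQ (n : ℕ) (hn : i + 1 < n + (t + 1)) : NegAt (maxHomIdeal 𝒜)
      (X R (M ⧸ torsionSubmodule (maxHomIdeal 𝒜) M) ω n) :=
    negAt_ext_of_depth _ htop _ _ (fun _ => negAt_ext_of_depthGE h1) n (by omega)
  let e₀ : Coker dl 0 ≃ₗ[R] M := (Submodule.quotEquivOfEq _ _ hπker.symm).trans
    (π.quotKerEquivOfSurjective hπsurj)
  have h0 (n : ℕ) (hn : i + 1 < n + (t + 1)) (hni : n < i + 1) :
      NegAt (maxHomIdeal 𝒜) (X R (Coker dl 0) ω n) :=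
    (NegAt.of_exact (pre_exact ω n (SES.of_submodule _)) (hMQ n hn)
      (negAt_ext_torsionSubmodule hω M (by omega))).of_equiv (preEquiv e₀ ω n)
  have hD (b : ℕ) (hb : i + 1 < b + 1 + (t + 1)) (hbi : b + 1 < i + 1) :
      NegAt (maxHomIdeal 𝒜) (dualHomology dl ω b) :=
    negAt_dualHomology b hcomplex (hH b 0 (by omega))
      (negAt_ext_coker hcomplex hC hH h0 b 1 le_rfl (by omega) (by omega))
  have hCd (j s : ℕ) (hj : i + 1 < j + (t + 1)) (hji : j ≤ i + 1) (hs : s ≤ i + 1 - j) :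
      NegAt (maxHomIdeal 𝒜) (X R (R ⧸ maxHomIdeal 𝒜) (C j →ₗ[R] ω) s) :=
    negAt_ext_of_depthGE (h4 j (by omega) hji) (by omega)
  have hE : Emb R (socle (maxHomIdeal 𝒜) (extModule R M ω (i + 1)))
      (X R (R ⧸ maxHomIdeal 𝒜) (dualRange dl ω (i + 1 - (t + 1))) (t + 1)) := by
    refine emb_socle_ext_dualRange hcomplex hCd hD (fun b hb => ?_) t _ le_rfl (by omega)
    obtain rfl : b = i := by omega
    exact (emb_socle_of_injective
      ((extModuleEquiv M ω b).trans (preEquiv e₀ ω (b + 1))).injective).trans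
      ((emb_socle_ext_coker hcomplex ht1 hC hH b 1 le_rfl (by omega)).trans
      ((emb_socle_dualHomology b hcomplex (hC b 1 (by omega) le_rfl (by omega))).trans
      (emb_socle_dualHomology_ext hcomplex (hCd _ _ (by omega) le_rfl (by omega)))))
  refine ⟨?_, ?_, ?_⟩
  · exact hE.trans ⟨(extModuleEquiv _ _ t).symm.toLinearMap, (extModuleEquiv _ _ t).symm.injective⟩
  · by_cases hN : NegAt (maxHomIdeal 𝒜) (dualRange dl ω (i + 1 - (t + 1)))
    · refine Or.inl (subsingleton_range_lcomp hnonneg hdim.le hω hωd htop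
        (fun _ => negAt_ext_of_depthGE hCM)
        (fun j hj => negAt_ext_of_depthGE (h3 (i + 1 - (t + 1)) (by omega)) (by omega))
        (Grading.ofDecomposition 𝒜 (𝒞 _)) _ ?_ hN)
      rintro j _ ⟨x, rfl⟩
      exact ⟨_, (Grading.ofDecomposition_proj_map (𝒞 _) (𝒞 _) _ (hdlhomog _) j x).symm⟩
    · exact depthGE_of_negAt_ext hN fun s hs =>
        have := subsingleton_ext_dualRange hcomplex hCd hD s (i + 1 - (t + 1)) (by omega)
          (by omega)
        NegAt.of_subsingleton _
  · rintro ⟨hnt, -⟩ hdepth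
    have := (negAt_ext_of_depthGE hdepth (Nat.lt_succ_self _)).subsingleton_ext
    obtain ⟨φ, hφ⟩ := hE
    have := hφ.subsingleton
    have hQ := subsingleton_ext_of_grading hnonneg hdim.le hnb
      ((Grading.ofDecomposition 𝒜 ℳ).quotient _ (Grading.proj_mem_torsionSubmodule _))
      (fun _ => negAt_ext_of_depthGE h1) (i := i + 1) (by omega)
    obtain ⟨n, hn⟩ := exists_pow_smul_ext M hQ
    have : Subsingleton (extModule R M ω (i + 1)) := subsingleton_of_socle (n := n) fun r hr x =>
      (extModuleEquiv M ω i).injective (by rw [map_smul, hn r hr, map_zero])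
    exact not_subsingleton _ this

end Paper
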